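/- arXiv:1710.11312 — 3 statements merged into one kernel-verified Lean document; each statement's English description precedes it below -/
import Mathlib

section
/- Let n ≥ 3, p ≥ 1, s₀ > 0, let q₀ > 0, and let L ∈ C⁰([0,∞)) ∩ C²((0,s₀)) be positive and nondecreasing on (0,∞), satisfy hypothesis (H) for s₀, and satisfy s·L''(s) ≥ −((3p+q₀−2)/(p+q₀))·L'(s) for all s ∈ (0,s₀). Let u₀ ∈ C⁰(ℝⁿ) be positive with u₀ < min{s₀^{2/p}, s₀^{2/(p+q₀)}} in ℝⁿ and ∫_{ℝⁿ} L(u₀) < ∞. For R > 0 let u_{0R} ∈ C³(B̄_R) satisfy 0 < u_{0R} < u₀ in B_R and u_{0R} = 0 on ∂B_R, and suppose that for each ε ∈ (0,1) there is a global classical solution u_{Rε} ∈ C⁰(B̄_R×[0,∞)) ∩ C^{2,1}(B̄_R×(0,∞)) of u_t = u^p Δu in B_R×(0,∞) with u_{Rε} = ε on ∂B_R×(0,∞), u_{Rε}(·,0) = u_{0R} + ε, and u_{Rε} ≥ ε, such that u_{Rε} decreases pointwise as ε ↘ 0 to a positive classical solution u_R of the corresponding problem with zero boundary data and initial data u_{0R}.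 Then there exists q₁ ∈ (0,q₀) such that for every q ∈ (0,q₁) there exist t₀ = t₀(q) > 0 and C = C(q) > 0, independent of R, with ‖u_R(·,t)‖_{L^q(B_R)} ≤ C · t^{−1/p} · L(1/t)^{−(np+2q)/(npq)} for all t ≥ t₀. -/
open Real Set MeasureTheory Metric Filter

/-- The Laplacian of a function on `ℝⁿ`, written via iterated Fréchet derivatives
in the coordinate directions. -/
noncomputable def lap {n : ℕ} (f : EuclideanSpace ℝ (Fin n) → ℝ)
    (x : EuclideanSpace ℝ (Fin n)) : ℝ :=
  ∑ i : Fin n, fderiv ℝ (fun y => fderiv ℝ f y (EuclideanSpace.single i 1)) x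
    (EuclideanSpace.single i 1)

/-- `u` is a global classical solution of `u_t = u^p Δu` on `B_R × (0,∞)` with
boundary value `ε` on `∂B_R × (0,∞)` and initial data `g`; the spatial smoothness
(`C²` in `x`) is required on the set `s` (either `B̄_R` or `B_R`). -/
def IsBallSol (n : ℕ) (p R ε : ℝ) (s : Set (EuclideanSpace ℝ (Fin n)))
    (g : EuclideanSpace ℝ (Fin n) → ℝ) (u : EuclideanSpace ℝ (Fin n) → ℝ → ℝ) : Prop :=
  ContinuousOn (fun z : (EuclideanSpace ℝ (Fin n)) × ℝ => u z.1 z.2)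
    (Metric.closedBall (0 : EuclideanSpace ℝ (Fin n)) R ×ˢ Set.Ici (0:ℝ)) ∧
  (∀ x ∈ Metric.closedBall (0 : EuclideanSpace ℝ (Fin n)) R, u x 0 = g x) ∧
  (∀ x ∈ Metric.sphere (0 : EuclideanSpace ℝ (Fin n)) R, ∀ t > (0:ℝ), u x t = ε) ∧
  (∀ t > (0:ℝ), ContDiffOn ℝ 2 (fun y => u y t) s) ∧
  (∀ x ∈ Metric.ball (0 : EuclideanSpace ℝ (Fin n)) R, ∀ t > (0:ℝ),
    HasDerivAt (fun τ => u x τ) (u x t ^ p * lap (fun y => u y t) x) t)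

lemma lap_nonneg_of_min {n : ℕ} {f : EuclideanSpace ℝ (Fin n) → ℝ}
    {x : EuclideanSpace ℝ (Fin n)} (hf : ContDiffAt ℝ 2 f x) (hmin : IsLocalMin f x) :
    0 ≤ lap f x := by
  unfold lap
  refine Finset.sum_nonneg fun i _ => ?_
  set e : EuclideanSpace ℝ (Fin n) := EuclideanSpace.single i 1
  set γ : ℝ → EuclideanSpace ℝ (Fin n) := fun s => x + s • e with hγ
  have hγ0 : γ 0 = x := by simp [hγ]
  have hγc : Continuous γ := by fun_prop
  have hγd : ∀ s, HasDerivAt γ e s := fun s => by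
    have h := ((hasDerivAt_id s).smul_const e).const_add x
    rw [one_smul] at h
    exact h
  have hev : ∀ᶠ y in nhds x, DifferentiableAt ℝ f y := by
    have := (hf.eventually (by simp))
    filter_upwards [this] with y hy
    exact hy.differentiableAt (by simp)
  have hev' : ∀ᶠ s in nhds (0:ℝ), DifferentiableAt ℝ f (γ s) := by
    have := hγc.tendsto 0
    rw [hγ0] at this
    exact this.eventually hev
  have hd1 : ∀ᶠ s in nhds (0:ℝ), deriv (f ∘ γ) s = fderiv ℝ f (γ s) e := by
    filter_upwards [hev'] with s hs
    exact (hs.hasFDerivAt.comp_hasDerivAt s (hγd s)).deriv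
  have hfd : DifferentiableAt ℝ (fun y => fderiv ℝ f y e) x := by
    have h1 : ContDiffAt ℝ 1 (fderiv ℝ f) x := hf.fderiv_right (by norm_num)
    exact (h1.differentiableAt (by simp)).clm_apply (differentiableAt_const e)
  have hd2 : HasDerivAt (deriv (f ∘ γ)) (fderiv ℝ (fun y => fderiv ℝ f y e) x e) 0 := by
    have h3 : HasDerivAt (fun s => fderiv ℝ f (γ s) e)
        (fderiv ℝ (fun y => fderiv ℝ f y e) x e) 0 := by
      have h4 : HasFDerivAt (fun y => fderiv ℝ f y e) (fderiv ℝ (fun y => fderiv ℝ f y e) x) (γ 0) := by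
        rw [hγ0]; exact hfd.hasFDerivAt
      exact h4.comp_hasDerivAt 0 (hγd 0)
    exact h3.congr_of_eventuallyEq hd1
  have hlm : IsLocalMin (f ∘ γ) 0 := by
    have h := hγc.tendsto 0
    rw [hγ0] at h
    have := h.eventually hmin
    simpa [IsLocalMin, IsMinFilter, hγ0] using this
  by_contra hneg
  push Not at hneg
  have hmax : IsLocalMax (f ∘ γ) 0 := by
    apply isLocalMax_of_deriv_deriv_neg
    · rw [hd2.deriv]; exact hneg
    · exact hlm.deriv_eq_zero
    · apply ContinuousAt.comp
      · rw [hγ0]; exact hf.continuousAt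
      · exact hγc.continuousAt
  have hconst : ∀ᶠ s in nhds (0:ℝ), (f ∘ γ) s = (f ∘ γ) 0 := by
    filter_upwards [hlm, hmax] with s h1 h2
    exact le_antisymm h2 h1
  have hdz : ∀ᶠ s in nhds (0:ℝ), deriv (f ∘ γ) s = 0 := by
    have h := hconst.eventually_nhds
    filter_upwards [h] with s hs
    have : (f ∘ γ) =ᶠ[nhds s] fun _ => (f ∘ γ) 0 := hs
    rw [this.deriv_eq]; simp
  have : HasDerivAt (deriv (f ∘ γ)) 0 0 := by
    have h0 : deriv (f ∘ γ) =ᶠ[nhds 0] fun _ => (0:ℝ) := hdz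
    exact (hasDerivAt_const (0:ℝ) (0:ℝ)).congr_of_eventuallyEq h0
  have := hd2.unique this
  linarith

lemma lap_lin {n : ℕ} {f g : EuclideanSpace ℝ (Fin n) → ℝ}
    {x : EuclideanSpace ℝ (Fin n)} (a : ℝ) (hf : ContDiffAt ℝ 2 f x) (hg : ContDiffAt ℝ 2 g x) :
    lap (fun y => a * f y - g y) x = a * lap f x - lap g x := by
  unfold lap
  rw [Finset.mul_sum, ← Finset.sum_sub_distrib]
  refine Finset.sum_congr rfl fun i _ => ?_
  set e : EuclideanSpace ℝ (Fin n) := EuclideanSpace.single i 1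
  have key : ∀ h : EuclideanSpace ℝ (Fin n) → ℝ, ContDiffAt ℝ 2 h x →
      (∀ᶠ y in nhds x, DifferentiableAt ℝ h y) ∧ DifferentiableAt ℝ (fun y => fderiv ℝ h y e) x := by
    intro h hh
    constructor
    · filter_upwards [hh.eventually (by simp)] with y hy
      exact hy.differentiableAt (by simp)
    · have h1 : ContDiffAt ℝ 1 (fderiv ℝ h) x := hh.fderiv_right (by norm_num)
      exact (h1.differentiableAt (by simp)).clm_apply (differentiableAt_const e)
  obtain ⟨hf1, hf2⟩ := key f hf
  obtain ⟨hg1, hg2⟩ := key g hg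
  have : (fun y => fderiv ℝ (fun y => a * f y - g y) y e) =ᶠ[nhds x]
      fun y => a * fderiv ℝ f y e - fderiv ℝ g y e := by
    filter_upwards [hf1, hg1] with y h1 h2
    have h3 : HasFDerivAt (fun y => a * f y - g y) (a • fderiv ℝ f y - fderiv ℝ g y) y :=
      (h1.hasFDerivAt.const_mul a).sub h2.hasFDerivAt
    rw [h3.fderiv]
    simp
  have h3 : HasFDerivAt (fun y => a * fderiv ℝ f y e - fderiv ℝ g y e)
      (a • fderiv ℝ (fun y => fderiv ℝ f y e) x - fderiv ℝ (fun y => fderiv ℝ g y e) x) x :=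
    (hf2.hasFDerivAt.const_mul a).sub hg2.hasFDerivAt
  rw [this.fderiv_eq, h3.fderiv]
  simp

lemma cmp_principle {E : Type*} [NormedAddCommGroup E] [ProperSpace E] (R T : ℝ) (d : E → ℝ → ℝ)
    (hc : ContinuousOn (fun z : E × ℝ => d z.1 z.2) (closedBall (0:E) R ×ˢ Icc 0 T))
    (h0 : ∀ x ∈ closedBall (0:E) R, 0 < d x 0)
    (hb : ∀ x ∈ sphere (0:E) R, ∀ t ∈ Ioc 0 T, 0 < d x t)
    (hi : ∀ x ∈ ball (0:E) R, ∀ t ∈ Ioc 0 T, d x t = 0 → (∀ y ∈ ball (0:E) R, 0 ≤ d y t) →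
      (∀ s ∈ Ico 0 t, 0 < d x s) → False) :
    ∀ x ∈ closedBall (0:E) R, ∀ t ∈ Icc 0 T, 0 < d x t := by
  set Q : Set (E × ℝ) := closedBall (0:E) R ×ˢ Icc 0 T with hQ
  have hQc : IsCompact Q := (isCompact_closedBall _ _).prod isCompact_Icc
  set Z : Set (E × ℝ) := Q ∩ (fun z : E × ℝ => d z.1 z.2) ⁻¹' Iic 0 with hZ
  have hZc : IsCompact Z := by
    apply hQc.of_isClosed_subset _ inter_subset_left
    exact hc.preimage_isClosed_of_isClosed hQc.isClosed isClosed_Iic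
  by_contra hcon
  push Not at hcon
  obtain ⟨x0, hx0, t0, ht0, hd0⟩ := hcon
  have hne : Z.Nonempty := ⟨(x0, t0), ⟨hx0, ht0⟩, hd0⟩
  obtain ⟨⟨x, t⟩, ⟨⟨hx, ht⟩, hd⟩, hmin⟩ := hZc.exists_isMinOn hne continuous_snd.continuousOn
  simp only [mem_preimage, mem_Iic] at hd hx ht
  have hpos : ∀ y ∈ closedBall (0:E) R, ∀ s ∈ Ico 0 t, 0 < d y s := by
    intro y hy s hs
    by_contra h
    push Not at h
    have := hmin (show (y, s) ∈ Z from ⟨⟨hy, hs.1, hs.2.le.trans ht.2⟩, h⟩)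
    simp at this
    linarith [hs.2]
  have ht0 : 0 < t := by
    rcases ht.1.eq_or_lt with h | h
    · subst h; exact absurd (h0 x hx) (not_lt.2 hd)
    · exact h
  have hnn : ∀ y ∈ closedBall (0:E) R, 0 ≤ d y t := by
    intro y hy
    have hcy : ContinuousOn (fun s => d y s) (Icc 0 T) := by
      have : ContinuousOn (fun s : ℝ => (y, s)) (Icc 0 T) := by fun_prop
      exact hc.comp this (fun s hs => ⟨hy, hs⟩)
    have h1 : Tendsto (fun s => d y s) (nhdsWithin t (Ico 0 t)) (nhds (d y t)) :=
      (hcy t ht).mono (fun s hs => ⟨hs.1, hs.2.le.trans ht.2⟩)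
    have : (nhdsWithin t (Ico 0 t)).NeBot := by
      rw [← mem_closure_iff_nhdsWithin_neBot, closure_Ico ht0.ne]
      exact ⟨ht0.le, le_rfl⟩
    refine ge_of_tendsto h1 ?_
    filter_upwards [self_mem_nhdsWithin] with s hs
    exact (hpos y hy s hs).le
  have hxb : x ∈ ball (0:E) R := by
    rcases (mem_closedBall.1 hx).eq_or_lt with h | h
    · exact absurd (hb x (mem_sphere.2 h) t ⟨ht0, ht.2⟩) (not_lt.2 hd)
    · exact mem_ball.2 h
  exact hi x hxb t ⟨ht0, ht.2⟩ (le_antisymm hd (hnn x hx)) (fun y hy => hnn y (ball_subset_closedBall hy))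
    (hpos x hx)

lemma deriv_nonpos_of_left_pos {f : ℝ → ℝ} {f' t : ℝ} (ht : 0 < t) (hf : HasDerivAt f f' t)
    (h0 : f t = 0) (hp : ∀ s ∈ Ico 0 t, 0 < f s) : f' ≤ 0 := by
  have h1 := (hasDerivAt_iff_tendsto_slope.1 hf).mono_left
    (nhdsWithin_mono t (show Iio t ⊆ {t}ᶜ from fun s hs => ne_of_lt hs))
  refine le_of_tendsto h1 ?_
  have : Ioo 0 t ∈ nhdsWithin t (Iio t) := Ioo_mem_nhdsLT ht
  filter_upwards [this] with s hs
  rw [slope_def_field, h0]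
  apply div_nonpos_of_nonneg_of_nonpos
  · have := hp s ⟨hs.1.le, hs.2⟩; linarith
  · linarith [hs.2]

lemma ab_strict {n : ℕ} {p R ε : ℝ} (hp : 1 ≤ p) {S : Set (EuclideanSpace ℝ (Fin n))}
    (hS : ball 0 R ⊆ S)
    {g : EuclideanSpace ℝ (Fin n) → ℝ} {u : EuclideanSpace ℝ (Fin n) → ℝ → ℝ}
    (hu : IsBallSol n p R ε S g u) (hε : 0 < ε) (hg : ∀ x ∈ closedBall 0 R, 0 < g x)
    (hpos : ∀ x ∈ ball 0 R, ∀ t > (0:ℝ), 0 < u x t) {lam η : ℝ} (hl : 1 < lam) (hη : 0 < η) :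
    ∀ x ∈ closedBall 0 R, ∀ t ≥ (0:ℝ),
      u x t < (lam + η * t) ^ (1/p) * u x (lam * t + η * t^2 / 2) := by
  obtain ⟨hc, hi, hb, hsm, ht⟩ := hu
  have hp0 : 0 < p := by linarith
  set m : ℝ → ℝ := fun t => (lam + η * t) ^ (1/p) with hm
  set τ : ℝ → ℝ := fun t => lam * t + η * t^2 / 2 with hτ
  have hm1 : ∀ t ≥ 0, 1 < m t := fun t ht => by
    apply Real.one_lt_rpow
    · nlinarith [mul_nonneg hη.le ht]
    · positivity
  have hτ0 : ∀ t ≥ 0, 0 ≤ τ t := fun t ht => by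
    have : 0 < lam := by linarith
    simp only [hτ]; positivity
  have hτp : ∀ t > 0, 0 < τ t := fun t ht => by
    have : 0 < lam := by linarith
    simp only [hτ]; positivity
  intro x hx t htt
  suffices h : 0 < m t * u x (τ t) - u x t by linarith
  refine cmp_principle R t (fun x t => m t * u x (τ t) - u x t) ?_ ?_ ?_ ?_ x hx t ⟨htt, le_rfl⟩
  · have h1 : ContinuousOn (fun z : EuclideanSpace ℝ (Fin n) × ℝ => u z.1 z.2)
        (closedBall 0 R ×ˢ Icc 0 t) := hc.mono (prod_mono le_rfl Icc_subset_Ici_self)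
    have h2 : ContinuousOn (fun z : EuclideanSpace ℝ (Fin n) × ℝ => u z.1 (τ z.2))
        (closedBall 0 R ×ˢ Icc 0 t) := by
      have h3 : ContinuousOn (fun z : EuclideanSpace ℝ (Fin n) × ℝ => (z.1, τ z.2))
        (closedBall 0 R ×ˢ Icc 0 t) := by
          simp only [hτ]; fun_prop
      exact hc.comp h3 (fun z hz => ⟨hz.1, hτ0 _ hz.2.1⟩)
    have h4 : ContinuousOn (fun z : EuclideanSpace ℝ (Fin n) × ℝ => m z.2)
        (closedBall 0 R ×ˢ Icc 0 t) := by
      simp only [hm]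
      apply ContinuousOn.rpow_const
      · fun_prop
      · intro z hz
        left
        have := mul_nonneg hη.le hz.2.1
        intro h; linarith
    exact (h4.mul h2).sub h1
  · intro y hy
    have h1 : τ 0 = 0 := by simp [hτ]
    simp only [h1, hi y hy]
    nlinarith [hm1 0 le_rfl, hg y hy]
  · intro y hy s hs
    simp only [hb y hy s hs.1, hb y hy _ (hτp s hs.1)]
    nlinarith [hm1 s hs.1.le]
  · intro y hy s hs h0 hnn hl0
    have hs0 := hs.1
    have hτs := hτp s hs0
    have hcd : ∀ r > 0, ContDiffAt ℝ 2 (fun z => u z r) y := fun r hr =>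
      (hsm r hr).contDiffAt (mem_of_superset (isOpen_ball.mem_nhds hy) hS)
    have hlap : 0 ≤ lap (fun z => m s * u z (τ s) - u z s) y := by
      apply lap_nonneg_of_min
      · exact (contDiffAt_const.mul (hcd _ hτs)).sub (hcd _ hs0)
      · filter_upwards [isOpen_ball.mem_nhds hy] with z hz
        have := hnn z hz
        linarith
    rw [lap_lin _ (hcd _ hτs) (hcd _ hs0)] at hlap
    have hbase : 0 < lam + η * s := by positivity
    have hdm : HasDerivAt m (η * (1/p) * (lam + η * s) ^ (1/p - 1)) s := by
      have h1 : HasDerivAt (fun t => lam + η * t) η s := by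
        simpa using ((hasDerivAt_id s).const_mul η).const_add lam
      exact h1.rpow_const (Or.inl hbase.ne')
    have hdτ : HasDerivAt τ (lam + η * s) s := by
      have h1 := ((hasDerivAt_id s).const_mul lam).add (((hasDerivAt_id s).pow 2).const_mul η |>.div_const 2)
      convert! h1 using 1
      simp; ring
    have hdu : HasDerivAt (fun r => u y (τ r)) (u y (τ s) ^ p * lap (fun z => u z (τ s)) y * (lam + η * s)) s :=
      HasDerivAt.comp s (ht y hy _ hτs) hdτ
    have hd := (hdm.mul hdu).sub (ht y hy s hs0)
    have hle := deriv_nonpos_of_left_pos hs0 hd h0 hl0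
    have hw : u y s = m s * u y (τ s) := by linarith
    have hmpow : m s ^ p = lam + η * s := by
      simp only [hm]
      rw [← Real.rpow_mul hbase.le, one_div_mul_cancel hp0.ne', Real.rpow_one]
    have hmpos : 0 < m s := by linarith [hm1 s hs0.le]
    have hup : 0 < u y (τ s) := hpos y hy _ hτs
    have hwp : u y s ^ p = (lam + η * s) * u y (τ s) ^ p := by
      rw [hw, Real.mul_rpow hmpos.le hup.le, hmpow]
    rw [hwp] at hle
    have e1 : 0 < η * (1/p) * (lam + η * s) ^ (1/p - 1) * u y (τ s) := by positivity
    have e2 : 0 ≤ (lam + η * s) * u y (τ s) ^ p * (m s * lap (fun y => u y (τ s)) y - lap (fun y => u y s) y) := by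
      apply mul_nonneg _ hlap
      positivity
    nlinarith [e1, e2, hle]

lemma ab_mono_eps {n : ℕ} {p R ε : ℝ} (hp : 1 ≤ p) {S : Set (EuclideanSpace ℝ (Fin n))}
    (hS : ball 0 R ⊆ S)
    {g : EuclideanSpace ℝ (Fin n) → ℝ} {u : EuclideanSpace ℝ (Fin n) → ℝ → ℝ}
    (hu : IsBallSol n p R ε S g u) (hε : 0 < ε) (hg : ∀ x ∈ closedBall 0 R, 0 < g x)
    (hpos : ∀ x ∈ ball 0 R, ∀ t > (0:ℝ), 0 < u x t)
    {x : EuclideanSpace ℝ (Fin n)} (hx : x ∈ ball 0 R) {t t' : ℝ} (h0 : 0 < t) (htt : t < t') :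
    t ^ (1/p) * u x t ≤ t' ^ (1/p) * u x t' := by
  have hp0 : 0 < p := by linarith
  have hxc := ball_subset_closedBall hx
  have hl : 1 < t' / t := by rwa [one_lt_div h0]
  have h1 : ∀ η > 0, u x t ≤ (t'/t + η * t) ^ (1/p) * u x (t'/t * t + η * t^2 / 2) :=
    fun η hη => (ab_strict hp hS hu hε hg hpos hl hη x hxc t h0.le).le
  have hcx : ContinuousOn (fun s => u x s) (Ici 0) := by
    have : ContinuousOn (fun s : ℝ => (x, s)) (Ici 0) := by fun_prop
    exact hu.1.comp this (fun s hs => ⟨hxc, hs⟩)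
  have hct : ContinuousAt (fun s => u x s) (t'/t * t + 0 * t^2/2) := by
    apply hcx.continuousAt
    apply Ici_mem_nhds
    field_simp; simp; linarith
  have hlim : Tendsto (fun η : ℝ => (t'/t + η * t) ^ (1/p) * u x (t'/t * t + η * t^2 / 2))
      (nhdsWithin 0 (Ioi 0)) (nhds ((t'/t + 0 * t) ^ (1/p) * u x (t'/t * t + 0 * t^2 / 2))) := by
    apply Tendsto.mono_left _ nhdsWithin_le_nhds
    apply Tendsto.mul
    · have : ContinuousAt (fun η : ℝ => (t'/t + η * t) ^ (1/p)) 0 := by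
        apply ContinuousAt.rpow_const
        · fun_prop
        · right; positivity
      exact this
    · have h2 : ContinuousAt (fun η : ℝ => t'/t * t + η * t^2 / 2) 0 := by fun_prop
      exact hct.tendsto.comp h2
  have h2 := ge_of_tendsto hlim (by filter_upwards [self_mem_nhdsWithin] with η hη using h1 η hη)
  have e : t'/t * t + 0 * t^2/2 = t' := by field_simp; ring
  rw [e] at h2
  simp only [zero_mul, add_zero] at h2
  rw [Real.div_rpow (by linarith) h0.le] at h2
  have hpt : 0 < t ^ (1/p) := by positivity
  calc t ^ (1/p) * u x t ≤ t ^ (1/p) * (t' ^ (1/p) / t ^ (1/p) * u x t') := by gcongr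
    _ = _ := by field_simp

lemma sup_bound {n : ℕ} {p R M : ℝ} {S : Set (EuclideanSpace ℝ (Fin n))}
    (hS : ball 0 R ⊆ S)
    {g : EuclideanSpace ℝ (Fin n) → ℝ} {u : EuclideanSpace ℝ (Fin n) → ℝ → ℝ}
    (hu : IsBallSol n p R 0 S g u) (hM : 0 ≤ M) (hg : ∀ x ∈ closedBall 0 R, g x ≤ M)
    (hpos : ∀ x ∈ ball 0 R, ∀ t > (0:ℝ), 0 < u x t) :
    ∀ x ∈ closedBall 0 R, ∀ t ≥ (0:ℝ), u x t ≤ M := by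
  obtain ⟨hc, hi, hb, hs, ht⟩ := hu
  intro x hx t htt
  have key : ∀ η > 0, u x t ≤ M + η * (1 + t) := by
    intro η hη
    suffices h : 0 < M + η * (1 + t) - u x t by linarith
    refine cmp_principle R t (fun x t => M + η * (1 + t) - u x t) ?_ ?_ ?_ ?_ x hx t ⟨htt, le_rfl⟩
    · have h1 : ContinuousOn (fun z : EuclideanSpace ℝ (Fin n) × ℝ => u z.1 z.2)
        (closedBall 0 R ×ˢ Icc 0 t) := hc.mono (prod_mono le_rfl Icc_subset_Ici_self)
      exact ContinuousOn.sub (by fun_prop) h1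
    · intro y hy
      simp only [hi y hy]
      linarith [hg y hy]
    · intro y hy s hs
      simp only [hb y hy s hs.1]
      have := hs.1
      have : 0 < η * (1 + s) := by positivity
      linarith
    · intro y hy s hs' h0 hnn hl0
      have hs0 := hs'.1
      have hcd : ContDiffAt ℝ 2 (fun z => u z s) y :=
        ((hs s hs0)).contDiffAt (mem_of_superset (isOpen_ball.mem_nhds hy) hS)
      have hlap : 0 ≤ lap (fun z => 0 * u z s - u z s) y := by
        apply lap_nonneg_of_min
        · exact (contDiffAt_const.mul hcd).sub hcd
        · filter_upwards [isOpen_ball.mem_nhds hy] with z hz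
          have := hnn z hz
          linarith
      rw [lap_lin _ hcd hcd] at hlap
      have hd1 : HasDerivAt (fun t : ℝ => M + η * (1 + t)) η s := by
        simpa using (((hasDerivAt_id s).const_add 1).const_mul η).const_add M
      have hle := deriv_nonpos_of_left_pos hs0 (hd1.sub (ht y hy s hs0)) h0 hl0
      have := Real.rpow_nonneg (hpos y hy s hs0).le p
      nlinarith
  refine le_of_forall_pos_le_add fun δ hδ => ?_
  have := key (δ / (1 + t)) (by positivity)
  rwa [div_mul_cancel₀ _ (by positivity)] at this

lemma sum_sq_eq_norm {n : ℕ} (l : EuclideanSpace ℝ (Fin n) →L[ℝ] ℝ) :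
    ∑ i : Fin n, (l (EuclideanSpace.single i 1)) ^ 2 = ‖l‖ ^ 2 := by
  obtain ⟨w, rfl⟩ := (InnerProductSpace.toDual ℝ (EuclideanSpace ℝ (Fin n))).surjective l
  rw [LinearIsometryEquiv.norm_map, EuclideanSpace.real_norm_sq_eq]
  refine Finset.sum_congr rfl fun i _ => ?_
  simp [EuclideanSpace.inner_single_right]

/-- the slice hypotheses -/
structure Slice {n : ℕ} (R M : ℝ) (v : EuclideanSpace ℝ (Fin n) → ℝ) : Prop where
  smooth : ContDiffOn ℝ 2 v (ball 0 R)
  cont : ContinuousOn v (closedBall 0 R)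
  bdry : ∀ x ∈ sphere 0 R, v x = 0
  pos : ∀ x ∈ ball 0 R, 0 < v x
  lt : ∀ x ∈ ball 0 R, v x < M

namespace Slice

variable {n : ℕ} {R M : ℝ} {v : EuclideanSpace ℝ (Fin n) → ℝ}

lemma tsupp (h : Slice R M v) {k : ℝ} (hk : 0 < k) {F : EuclideanSpace ℝ (Fin n) → ℝ}
    (hF : ∀ x ∈ ball 0 R, v x ≤ k → F x = 0) :
    HasCompactSupport (indicator (ball 0 R) F) ∧
      tsupport (indicator (ball 0 R) F) ⊆ ball 0 R := by
  set K : Set (EuclideanSpace ℝ (Fin n)) := closedBall 0 R ∩ v ⁻¹' Ici k with hK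
  have hKc : IsCompact K := by
    apply (isCompact_closedBall (0 : EuclideanSpace ℝ (Fin n)) R).of_isClosed_subset _ inter_subset_left
    exact h.cont.preimage_isClosed_of_isClosed isClosed_closedBall isClosed_Ici
  have hKb : K ⊆ ball 0 R := by
    rintro x ⟨hx, hx2⟩
    rcases (mem_closedBall.1 hx).eq_or_lt with h1 | h1
    · have := h.bdry x (mem_sphere.2 h1)
      simp only [mem_preimage, mem_Ici, this] at hx2
      linarith
    · exact mem_ball.2 h1
  have hs : Function.support (indicator (ball 0 R) F) ⊆ K := by
    intro x hx
    have hxb : x ∈ ball (0 : EuclideanSpace ℝ (Fin n)) R := by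
      by_contra hn; exact hx (indicator_of_notMem hn _)
    refine ⟨ball_subset_closedBall hxb, ?_⟩
    by_contra hn
    simp only [mem_preimage, mem_Ici, not_le] at hn
    exact hx (by rw [indicator_of_mem hxb, hF x hxb hn.le])
  have ht : tsupport (indicator (ball 0 R) F) ⊆ K := closure_minimal hs hKc.isClosed
  exact ⟨hKc.of_isClosed_subset (isClosed_tsupport _) ht, ht.trans hKb⟩

lemma ind_ev {F : EuclideanSpace ℝ (Fin n) → ℝ} {x : EuclideanSpace ℝ (Fin n)}
    (hx : x ∈ ball 0 R) : indicator (ball 0 R) F =ᶠ[nhds x] F := by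
  filter_upwards [isOpen_ball.mem_nhds hx] with y hy
  exact indicator_of_mem hy _

lemma ind_cont (h : Slice R M v) {k : ℝ} (hk : 0 < k) {F : EuclideanSpace ℝ (Fin n) → ℝ}
    (hF : ∀ x ∈ ball 0 R, v x ≤ k → F x = 0) (hc : ContinuousOn F (ball 0 R)) :
    Continuous (indicator (ball 0 R) F) := by
  apply continuous_of_tsupport
  intro x hx
  have hxb := (h.tsupp hk hF).2 hx
  exact (hc.continuousAt (isOpen_ball.mem_nhds hxb)).congr (ind_ev hxb).symm

lemma ind_integrable (h : Slice R M v) {k : ℝ} (hk : 0 < k) {F : EuclideanSpace ℝ (Fin n) → ℝ}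
    (hF : ∀ x ∈ ball 0 R, v x ≤ k → F x = 0) (hc : ContinuousOn F (ball 0 R)) :
    Integrable (indicator (ball 0 R) F) :=
  (h.ind_cont hk hF hc).integrable_of_hasCompactSupport (h.tsupp hk hF).1

lemma ind_contDiff (h : Slice R M v) {k : ℝ} (hk : 0 < k) {F : EuclideanSpace ℝ (Fin n) → ℝ}
    (hF : ∀ x ∈ ball 0 R, v x ≤ k → F x = 0) (hc : ContDiffOn ℝ 1 F (ball 0 R)) :
    ContDiff ℝ 1 (indicator (ball 0 R) F) := by
  rw [contDiff_iff_contDiffAt]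
  intro x
  by_cases hx : x ∈ tsupport (indicator (ball 0 R) F)
  swap
  · exact contDiffAt_const.congr_of_eventuallyEq (notMem_tsupport_iff_eventuallyEq.1 hx)
  have hxb := (h.tsupp hk hF).2 hx
  exact (hc.contDiffAt (isOpen_ball.mem_nhds hxb)).congr_of_eventuallyEq (ind_ev hxb)

lemma fderiv_cont (h : Slice R M v) : ContDiffOn ℝ 1 (fderiv ℝ v) (ball 0 R) :=
  h.smooth.fderiv_of_isOpen isOpen_ball (by norm_num)

lemma comp_fderiv (h : Slice R M v) {ψ ψ' : ℝ → ℝ}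
    (hd : ∀ s ∈ Ioo 0 M, HasDerivAt ψ (ψ' s) s) {x : EuclideanSpace ℝ (Fin n)}
    (hx : x ∈ ball 0 R) : HasFDerivAt (fun y => ψ (v y)) (ψ' (v x) • fderiv ℝ v x) x :=
  (hd (v x) ⟨h.pos x hx, h.lt x hx⟩).comp_hasFDerivAt x
    ((h.smooth.contDiffAt (isOpen_ball.mem_nhds hx)).differentiableAt (by simp)).hasFDerivAt

lemma cont_ball (h : Slice R M v) : ContinuousOn v (ball 0 R) := h.cont.mono ball_subset_closedBall

lemma comp_contDiff (h : Slice R M v) {ψ ψ' : ℝ → ℝ}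
    (hd : ∀ s ∈ Ioo 0 M, HasDerivAt ψ (ψ' s) s) (hc : ContinuousOn ψ' (Ioo 0 M)) :
    ContDiffOn ℝ 1 (fun y => ψ (v y)) (ball 0 R) := by
  have h1 : ContDiffOn ℝ 1 ψ (Ioo 0 M) := by
    rw [contDiffOn_one_iff_derivWithin isOpen_Ioo.uniqueDiffOn]
    refine ⟨fun s hs => (hd s hs).differentiableAt.differentiableWithinAt, ?_⟩
    refine hc.congr fun s hs => ?_
    rw [derivWithin_of_isOpen isOpen_Ioo hs, (hd s hs).deriv]
  exact h1.comp (h.smooth.of_le (by norm_num)) (fun x hx => ⟨h.pos x hx, h.lt x hx⟩)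

lemma ibp (h : Slice R M v) {k : ℝ} (hk : 0 < k) {ψ ψ' : ℝ → ℝ}
    (hd : ∀ s ∈ Ioo 0 M, HasDerivAt ψ (ψ' s) s) (hc : ContinuousOn ψ' (Ioo 0 M))
    (h0 : ∀ s ∈ Ioc 0 k, ψ s = 0) (h0' : ∀ s ∈ Ioc 0 k, ψ' s = 0) :
    IntegrableOn (fun x => ψ (v x) * lap v x) (ball 0 R) ∧
    IntegrableOn (fun x => ψ' (v x) * ‖fderiv ℝ v x‖ ^ 2) (ball 0 R) ∧
    ∫ x in ball 0 R, ψ (v x) * lap v x = - ∫ x in ball 0 R, ψ' (v x) * ‖fderiv ℝ v x‖ ^ 2 := by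
  have hψc : ContinuousOn (fun x => ψ (v x)) (ball 0 R) := (h.comp_contDiff hd hc).continuousOn
  have hψ'c : ContinuousOn (fun x => ψ' (v x)) (ball 0 R) :=
    hc.comp h.cont_ball (fun x hx => ⟨h.pos x hx, h.lt x hx⟩)
  set e : Fin n → EuclideanSpace ℝ (Fin n) := fun i => EuclideanSpace.single i 1 with he
  have hgc : ∀ i, ContDiffOn ℝ 1 (fun y => fderiv ℝ v y (e i)) (ball 0 R) := fun i =>
    h.fderiv_cont.clm_apply contDiffOn_const
  have hggc : ∀ i, ContinuousOn (fun x => fderiv ℝ (fun y => fderiv ℝ v y (e i)) x (e i)) (ball 0 R) :=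
    fun i => ((hgc i).continuousOn_fderiv_of_isOpen isOpen_ball (by norm_num)).clm_apply continuousOn_const
  set f := indicator (ball 0 R) (fun x => ψ (v x)) with hf
  have hz : ∀ x ∈ ball (0 : EuclideanSpace ℝ (Fin n)) R, v x ≤ k → ψ (v x) = 0 :=
    fun x hx hxk => h0 _ ⟨h.pos x hx, hxk⟩
  have hz' : ∀ x ∈ ball (0 : EuclideanSpace ℝ (Fin n)) R, v x ≤ k → ψ' (v x) = 0 :=
    fun x hx hxk => h0' _ ⟨h.pos x hx, hxk⟩
  have hfC : ContDiff ℝ 1 f := h.ind_contDiff hk hz (h.comp_contDiff hd hc)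
  have hfts := (h.tsupp hk hz).2
  have e1 : ∀ i, (fun x => f x * fderiv ℝ (fun y => fderiv ℝ v y (e i)) x (e i)) =
      indicator (ball 0 R) (fun x => ψ (v x) * fderiv ℝ (fun y => fderiv ℝ v y (e i)) x (e i)) := by
    intro i
    ext x
    by_cases hx : x ∈ ball (0 : EuclideanSpace ℝ (Fin n)) R
    · simp only [hf, indicator_of_mem hx]
    · simp only [hf, indicator_of_notMem hx, zero_mul]
  have e2 : ∀ i, (fun x => fderiv ℝ f x (e i) * fderiv ℝ v x (e i)) =
      indicator (ball 0 R) (fun x => ψ' (v x) * (fderiv ℝ v x (e i)) ^ 2) := by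
    intro i
    ext x
    by_cases hx : x ∈ ball (0 : EuclideanSpace ℝ (Fin n)) R
    · simp only [indicator_of_mem hx]
      rw [(ind_ev hx).fderiv_eq, (h.comp_fderiv hd hx).fderiv]
      simp; ring
    · simp only [indicator_of_notMem hx]
      have : fderiv ℝ f x = 0 := by
        by_contra hne
        exact hx (hfts (support_fderiv_subset ℝ hne))
      simp [this]
  have i1 : ∀ i, Integrable (indicator (ball 0 R) (fun x => ψ (v x) * fderiv ℝ (fun y => fderiv ℝ v y (e i)) x (e i))) :=
    fun i => h.ind_integrable hk (fun x hx hxk => by rw [hz x hx hxk, zero_mul]) (hψc.mul (hggc i))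
  have i2 : ∀ i, Integrable (indicator (ball 0 R) (fun x => ψ' (v x) * (fderiv ℝ v x (e i)) ^ 2)) :=
    fun i => h.ind_integrable hk (fun x hx hxk => by rw [hz' x hx hxk, zero_mul])
      (hψ'c.mul ((hgc i).continuousOn.pow 2))
  have i3 : ∀ i, Integrable (fun x => f x * fderiv ℝ v x (e i)) := by
    intro i
    have := h.ind_integrable hk (F := fun x => ψ (v x) * fderiv ℝ v x (e i))
      (fun x hx hxk => by rw [hz x hx hxk, zero_mul]) (hψc.mul (hgc i).continuousOn)
    convert! this using 1
    funext x
    by_cases hx : x ∈ ball (0 : EuclideanSpace ℝ (Fin n)) R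
    · simp only [hf, indicator_of_mem hx]
    · simp only [hf, indicator_of_notMem hx, zero_mul]
  have key : ∀ i, ∫ x in ball 0 R, ψ (v x) * fderiv ℝ (fun y => fderiv ℝ v y (e i)) x (e i) =
      - ∫ x in ball 0 R, ψ' (v x) * (fderiv ℝ v x (e i)) ^ 2 := by
    intro i
    rw [← integral_indicator measurableSet_ball, ← integral_indicator measurableSet_ball, ← e1 i, ← e2 i]
    apply integral_mul_fderiv_eq_neg_fderiv_mul_of_integrable
    · rw [e2 i]; exact i2 i
    · rw [e1 i]; exact i1 i
    · exact i3 i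
    · intro x _; exact (hfC.differentiable (by simp)) x
    · intro x hx
      exact ((hgc i).contDiffAt (isOpen_ball.mem_nhds (hfts hx))).differentiableAt (by simp)
  have j1 : ∀ i, IntegrableOn (fun x => ψ (v x) * fderiv ℝ (fun y => fderiv ℝ v y (e i)) x (e i)) (ball 0 R) :=
    fun i => (integrable_indicator_iff measurableSet_ball).1 (i1 i)
  have j2 : ∀ i, IntegrableOn (fun x => ψ' (v x) * (fderiv ℝ v x (e i)) ^ 2) (ball 0 R) :=
    fun i => (integrable_indicator_iff measurableSet_ball).1 (i2 i)
  have s1 : (fun x => ψ (v x) * lap v x) =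
      fun x => ∑ i, ψ (v x) * fderiv ℝ (fun y => fderiv ℝ v y (e i)) x (e i) := by
    ext x; rw [lap, Finset.mul_sum]
  have s2 : (fun x => ψ' (v x) * ‖fderiv ℝ v x‖ ^ 2) =
      fun x => ∑ i, ψ' (v x) * (fderiv ℝ v x (e i)) ^ 2 := by
    ext x; rw [← sum_sq_eq_norm, Finset.mul_sum]
  rw [s1, s2]
  refine ⟨integrable_finsetSum _ fun i _ => j1 i, integrable_finsetSum _ fun i _ => j2 i, ?_⟩
  rw [integral_finsetSum _ fun i _ => j1 i, integral_finsetSum _ fun i _ => j2 i,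
    ← Finset.sum_neg_distrib]
  exact Finset.sum_congr rfl fun i _ => key i

end Slice

lemma hasDerivAt_max_sq (x : ℝ) : HasDerivAt (fun y : ℝ => (max y 0) ^ 2) (2 * max x 0) x := by
  rcases lt_trichotomy x 0 with h | h | h
  · have : (fun y : ℝ => (max y 0) ^ 2) =ᶠ[nhds x] fun _ => 0 := by
      filter_upwards [gt_mem_nhds h] with y hy
      simp [max_eq_right hy.le]
    rw [max_eq_right h.le, mul_zero]
    exact (hasDerivAt_const x (0:ℝ)).congr_of_eventuallyEq this
  · subst h
    rw [hasDerivAt_iff_tendsto_slope]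
    have h1 : Tendsto (fun y : ℝ => 2 * max y 0 - max y 0) (nhdsWithin 0 {0}ᶜ) (nhds (2 * max 0 0)) := by
      have : Continuous (fun y : ℝ => 2 * max y 0 - max y 0) := by fun_prop
      have h2 := (this.tendsto 0).mono_left (nhdsWithin_le_nhds (s := {0}ᶜ))
      simpa using h2
    refine h1.congr' ?_
    filter_upwards [self_mem_nhdsWithin] with y hy
    have hy' : y ≠ 0 := hy
    rw [slope_def_field]
    rcases le_total y 0 with h | h
    · simp [max_eq_right h]
    · simp [max_eq_left h]; field_simp; ring
  · have : (fun y : ℝ => (max y 0) ^ 2) =ᶠ[nhds x] fun y => y ^ 2 := by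
      filter_upwards [lt_mem_nhds h] with y hy
      simp [max_eq_left hy.le]
    rw [max_eq_left h.le]
    have h2 := hasDerivAt_pow 2 x
    exact (by simpa using h2 : HasDerivAt (fun y => y ^ 2) (2 * x) x).congr_of_eventuallyEq this

lemma hasDerivAt_max_cube (x : ℝ) : HasDerivAt (fun y : ℝ => (max y 0) ^ 3) (3 * (max x 0) ^ 2) x := by
  have h1 := (hasDerivAt_max_sq x).mul (hasDerivAt_id x)
  have key : ∀ y : ℝ, (max y 0) * y = (max y 0) ^ 2 := by
    intro y
    rcases le_total y 0 with h | h
    · simp [max_eq_right h]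
    · simp [max_eq_left h]; ring
  convert! h1 using 1
  · funext y
    simp only [Pi.mul_apply, id]
    linear_combination (- max y 0) * key y
  · simp only [id]
    linear_combination (-2) * key x

/-- cutoff -/
noncomputable def hh (k s : ℝ) : ℝ := max (1 - k / s) 0

lemma hh_nonneg (k s : ℝ) : 0 ≤ hh k s := le_max_right _ _
lemma hh_le_one {k s : ℝ} (hk : 0 < k) (hs : 0 < s) : hh k s ≤ 1 := by
  apply max_le _ zero_le_one
  have : 0 < k / s := by positivity
  linarith
lemma hh_zero {k s : ℝ} (hs : 0 < s) (h : s ≤ k) : hh k s = 0 := by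
  apply max_eq_right
  have : 1 ≤ k / s := by rwa [one_le_div hs]
  linarith
lemma hh_ge (k s : ℝ) : 1 - k / s ≤ hh k s := le_max_left _ _

lemma hh_arg {k s : ℝ} (hs : 0 < s) : HasDerivAt (fun s => 1 - k / s) (k / s ^ 2) s := by
  have h := ((hasDerivAt_inv hs.ne').const_mul k).const_sub 1
  convert! h using 1
  field_simp

lemma hh_sq_deriv {k s : ℝ} (hs : 0 < s) :
    HasDerivAt (fun s => hh k s ^ 2) (2 * hh k s * (k / s ^ 2)) s := by
  have h := HasDerivAt.comp s (hasDerivAt_max_sq (1 - k/s)) (hh_arg (k := k) hs)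
  exact h

lemma hh_cube_deriv {k s : ℝ} (hs : 0 < s) :
    HasDerivAt (fun s => hh k s ^ 3) (3 * hh k s ^ 2 * (k / s ^ 2)) s := by
  have h := HasDerivAt.comp s (hasDerivAt_max_cube (1 - k/s)) (hh_arg (k := k) hs)
  exact h

lemma hh_cont (k : ℝ) : ContinuousOn (hh k) (Ioi 0) := by
  unfold hh
  apply ContinuousOn.sup _ continuousOn_const
  apply ContinuousOn.sub continuousOn_const
  exact continuousOn_const.div continuousOn_id (fun x hx => ne_of_gt hx)

lemma sobolev_real {n : ℕ} (hn : 3 ≤ n) : ∃ A : ℝ, 0 < A ∧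
    ∀ w : EuclideanSpace ℝ (Fin n) → ℝ, ContDiff ℝ 1 w → HasCompactSupport w →
    ∀ r : ℝ, 0 < r → r < 2 → ∀ S : Set (EuclideanSpace ℝ (Fin n)), MeasurableSet S →
      volume S ≠ ⊤ → Function.support w ⊆ S →
      ∫ x, |w x| ^ r ≤ (A * ∫ x, ‖fderiv ℝ w x‖ ^ 2) ^ (r/2) *
        (volume.real S) ^ (1 - r / 2 * ((n:ℝ) - 2) / n) := by
  have hn' : (3:ℝ) ≤ n := by exact_mod_cast hn
  set P : NNReal := (2 * n / (n - 2) : ℝ).toNNReal with hP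
  have hPr : (P : ℝ) = 2 * n / (n - 2) := Real.coe_toNNReal _ (by
    apply div_nonneg <;> linarith)
  have hPinv : (P : ℝ)⁻¹ = ((n:ℝ) - 2) / (2 * n) := by rw [hPr, inv_div]
  set A0 := SNormLESNormFDerivOfEqConst ℝ (volume : Measure (EuclideanSpace ℝ (Fin n))) ((2:NNReal):ℝ)
  refine ⟨((A0:ℝ) + 1) ^ 2, by positivity, ?_⟩
  intro w hw hwc r hr hr2 S hS hSf hwS
  have h1 : eLpNorm w P volume ≤ A0 * eLpNorm (fderiv ℝ w) (2:NNReal) volume := by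
    apply eLpNorm_le_eLpNorm_fderiv_of_eq volume hw hwc (p := 2) (p' := P) (by norm_num)
    · simp; omega
    · rw [hPinv]; simp
      have : (n:ℝ) ≠ 0 := by linarith
      field_simp
  have hrP : ENNReal.ofReal r ≤ (P : ENNReal) := by
    rw [← ENNReal.ofReal_coe_nnreal, hPr]
    apply ENNReal.ofReal_le_ofReal
    have : 2 ≤ 2 * (n:ℝ) / (n - 2) := by rw [le_div_iff₀ (by linarith)]; linarith
    linarith
  have h2 := eLpNorm_le_eLpNorm_mul_rpow_measure_univ (μ := volume.restrict S) hrP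
    hw.continuous.aestronglyMeasurable
  have hres : ∀ e : ENNReal, eLpNorm w e (volume.restrict S) = eLpNorm w e volume := by
    intro e
    rw [← eLpNorm_indicator_eq_eLpNorm_restrict hS, indicator_eq_self.2 hwS]
  rw [hres, hres] at h2
  have hwr : MemLp w (ENNReal.ofReal r) volume := hw.continuous.memLp_of_hasCompactSupport hwc
  have hdw : MemLp (fderiv ℝ w) (2:ENNReal) volume :=
    (hw.continuous_fderiv (by simp)).memLp_of_hasCompactSupport (hwc.fderiv ℝ)
  have e1 : eLpNorm w (ENNReal.ofReal r) volume = ENNReal.ofReal ((∫ x, |w x| ^ r) ^ r⁻¹) := by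
    rw [hwr.eLpNorm_eq_integral_rpow_norm (by simpa using hr) (by simp)]
    simp [ENNReal.toReal_ofReal hr.le]
  have e2 : eLpNorm (fderiv ℝ w) (2:NNReal) volume
      = ENNReal.ofReal ((∫ x, ‖fderiv ℝ w x‖ ^ 2) ^ (1/2:ℝ)) := by
    have := hdw.eLpNorm_eq_integral_rpow_norm (by simp) (by simp)
    simpa using this
  set D := ∫ x, ‖fderiv ℝ w x‖ ^ 2 with hD
  set I := ∫ x, |w x| ^ r with hI
  have hD0 : 0 ≤ D := integral_nonneg fun x => by positivity
  have hI0 : 0 ≤ I := integral_nonneg fun x => by positivity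
  have hSr : volume S = ENNReal.ofReal (volume.real S) := by
    simp [Measure.real, ENNReal.ofReal_toReal hSf]
  set m := volume.real S with hm
  have hm0 : 0 ≤ m := measureReal_nonneg
  have hexp : 0 ≤ 1 / r - ((n:ℝ) - 2) / (2 * n) := by
    have a1 : 1 / 2 ≤ 1 / r := one_div_le_one_div_of_le hr hr2.le
    have a2 : ((n:ℝ) - 2) / (2 * n) ≤ 1 / 2 := by
      rw [div_le_div_iff₀ (by linarith) (by norm_num)]; linarith
    linarith
  have h3 : ENNReal.ofReal (I ^ r⁻¹) ≤ ENNReal.ofReal (A0 * D ^ (1/2:ℝ) *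
      m ^ (1 / r - ((n:ℝ) - 2) / (2 * n))) := by
    rw [← e1]
    refine h2.trans ?_
    rw [Measure.restrict_apply_univ, ENNReal.toReal_ofReal hr.le, ENNReal.coe_toReal, one_div (P:ℝ), hPinv,
      hSr, ENNReal.ofReal_rpow_of_nonneg hm0 hexp, ENNReal.ofReal_mul (by positivity), ENNReal.ofReal_mul (by positivity)]
    gcongr
    refine h1.trans ?_
    rw [e2, ENNReal.ofReal_coe_nnreal]
  have h4 := (ENNReal.ofReal_le_ofReal_iff (by positivity)).1 h3
  have h5 : I = (I ^ r⁻¹) ^ r := by rw [← Real.rpow_mul hI0, inv_mul_cancel₀ hr.ne', Real.rpow_one]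
  rw [h5]
  calc (I ^ r⁻¹) ^ r ≤ (A0 * D ^ (1/2:ℝ) * m ^ (1 / r - ((n:ℝ) - 2) / (2 * n))) ^ r := by
        gcongr
    _ ≤ ((A0 + 1) * D ^ (1/2:ℝ) * m ^ (1 / r - ((n:ℝ) - 2) / (2 * n))) ^ r := by
        gcongr; linarith
    _ = _ := by
        rw [Real.mul_rpow (by positivity) (by positivity), Real.mul_rpow (by positivity) (by positivity),
          Real.mul_rpow (by positivity) (by positivity), ← Real.rpow_mul hD0, ← Real.rpow_mul hm0,
          ← Real.rpow_natCast, ← Real.rpow_mul (by positivity)]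
        have : (n:ℝ) ≠ 0 := by linarith
        have e3 : ((2:ℕ):ℝ) * (r / 2) = r := by push_cast; ring
        have e4 : 1 / 2 * r = r / 2 := by ring
        have e5 : (1 / r - ((n:ℝ) - 2) / (2 * n)) * r = 1 - r / 2 * (n - 2) / n := by
          field_simp
        rw [e3, e4, e5]

lemma hh_mul {k s : ℝ} (hs : 0 < s) : hh k s * (k / s) = hh k s * (1 - hh k s) := by
  by_cases h : hh k s = 0
  · simp [h]
  · have : hh k s = 1 - k / s := by
      unfold hh at h ⊢
      rcases max_choice (1 - k / s) 0 with h1 | h1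
      · exact h1
      · exact absurd h1 h
    rw [this]; ring

lemma psi_deriv {k s : ℝ} (hs : 0 < s) (e : ℝ) :
    HasDerivAt (fun s => s ^ e * hh k s ^ 3)
      (s ^ (e - 1) * (e * hh k s ^ 3 + 3 * hh k s ^ 2 * (1 - hh k s))) s := by
  have h := (Real.hasDerivAt_rpow_const (p := e) (Or.inl hs.ne')).mul (hh_cube_deriv (k := k) hs)
  convert! h using 1
  have e1 : s ^ e = s ^ (e - 1) * s := by
    rw [Real.rpow_sub_one hs.ne']; field_simp
  have := hh_mul (k := k) hs
  rw [e1]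
  have e2 : s ^ (e-1) * s * (3 * hh k s ^ 2 * (k / s ^ 2)) =
    s ^ (e-1) * (3 * hh k s) * (hh k s * (k/s)) := by field_simp
  rw [e2, this]; ring

lemma G_deriv {k s : ℝ} (hs : 0 < s) (e : ℝ) :
    HasDerivAt (fun s => s ^ e * hh k s ^ 2)
      (s ^ (e - 1) * (e * hh k s ^ 2 + 2 * hh k s * (1 - hh k s))) s := by
  have h := (Real.hasDerivAt_rpow_const (p := e) (Or.inl hs.ne')).mul (hh_sq_deriv (k := k) hs)
  convert! h using 1
  have e1 : s ^ e = s ^ (e - 1) * s := by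
    rw [Real.rpow_sub_one hs.ne']; field_simp
  have := hh_mul (k := k) hs
  rw [e1]
  have e2 : s ^ (e-1) * s * (2 * hh k s * (k / s ^ 2)) =
    s ^ (e-1) * 2 * (hh k s * (k/s)) := by field_simp
  rw [e2, this]; ring

lemma solve_Z {Z K m b θ : ℝ} (hZ : 0 ≤ Z) (hK : 0 ≤ K) (hm : 0 ≤ m) (hθ : θ < 1)
    (h : Z ≤ (K * Z) ^ θ * m ^ b) : Z ≤ K ^ (θ / (1 - θ)) * m ^ (b / (1 - θ)) := by
  rcases hZ.eq_or_lt with h0 | h0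
  · rw [← h0]; positivity
  have h1 : Z ^ (1 - θ) ≤ K ^ θ * m ^ b := by
    rw [Real.rpow_sub h0, Real.rpow_one, div_le_iff₀ (by positivity)]
    rw [Real.mul_rpow hK hZ] at h
    linarith
  have h2 : (Z ^ (1 - θ)) ^ (1 / (1 - θ)) ≤ (K ^ θ * m ^ b) ^ (1 / (1 - θ)) := by
    apply Real.rpow_le_rpow (by positivity) h1
    apply one_div_nonneg.2; linarith
  rw [← Real.rpow_mul hZ, mul_one_div_cancel (by linarith), Real.rpow_one,
    Real.mul_rpow (by positivity) (by positivity), ← Real.rpow_mul hK, ← Real.rpow_mul hm] at h2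
  rwa [mul_one_div, mul_one_div] at h2

lemma key_spatial {n : ℕ} (hn : 3 ≤ n) {p q : ℝ} (hp : 1 ≤ p) (hq : 0 < q) (hq1 : q < 1) :
    ∃ C : ℝ, 0 < C ∧ ∀ (R M : ℝ) (v : EuclideanSpace ℝ (Fin n) → ℝ), Slice R M v →
      ∀ k : ℝ, 0 < k → ∀ t : ℝ, 0 < t →
      (∀ x ∈ ball 0 R, -(v x) / (p * t) ≤ v x ^ p * lap v x) →
      ∫ x in ball 0 R, v x ^ q * hh k (v x) ^ 3 ≤
        C * t ^ (-q / p) * (volume.real {x ∈ ball 0 R | k < v x}) ^ (1 + 2 * q / (n * p)) := by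
  obtain ⟨A, hA, hS⟩ := sobolev_real hn
  have hn' : (3:ℝ) ≤ n := by exact_mod_cast hn
  set γ := (p + q) / 2 with hγ
  set B := (γ + 2) ^ 2 / (q * p) with hB
  have hBp : 0 < B := by positivity
  refine ⟨(A * B) ^ (q / p), by positivity, ?_⟩
  intro R M v hv k hk t ht hlap
  have hhz : ∀ s ∈ Ioc 0 k, hh k s = 0 := fun s hs => hh_zero hs.1 hs.2
  have hhc : ContinuousOn (hh k) (Ioo 0 M) := (hh_cont k).mono (fun s hs => hs.1)
  have hpw : ∀ e : ℝ, ContinuousOn (fun s : ℝ => s ^ e) (Ioo 0 M) := fun e s hs =>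
    (Real.continuousAt_rpow_const s e (Or.inl hs.1.ne')).continuousWithinAt
  obtain ⟨i1, i2, i3⟩ := hv.ibp hk (ψ := fun s => s ^ (p + q - 1) * hh k s ^ 3)
    (ψ' := fun s => s ^ (p + q - 1 - 1) * ((p + q - 1) * hh k s ^ 3 + 3 * hh k s ^ 2 * (1 - hh k s)))
    (fun s hs => psi_deriv hs.1 _)
    ((hpw _).mul (((hhc.pow 3).const_mul _).add (((hhc.pow 2).const_mul _).mul (continuousOn_const.sub hhc))))
    (fun s hs => by simp [hhz s hs]) (fun s hs => by simp [hhz s hs])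
  set G' : ℝ → ℝ := fun s => s ^ (γ - 1) * (γ * hh k s ^ 2 + 2 * hh k s * (1 - hh k s)) with hG'
  have hGd : ∀ s ∈ Ioo 0 M, HasDerivAt (fun s => s ^ γ * hh k s ^ 2) (G' s) s :=
    fun s hs => G_deriv hs.1 _
  have hGc : ContinuousOn G' (Ioo 0 M) :=
    ((hpw _).mul (((hhc.pow 2).const_mul _).add (((hhc.const_mul _)).mul (continuousOn_const.sub hhc))))
  set F : EuclideanSpace ℝ (Fin n) → ℝ := fun x => v x ^ γ * hh k (v x) ^ 2 with hF
  have hF0 : ∀ x ∈ ball 0 R, v x ≤ k → F x = 0 := fun x hx hxk => by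
    simp [hF, hhz (v x) ⟨hv.pos x hx, hxk⟩]
  set w := indicator (ball 0 R) F with hw
  have hFc : ContDiffOn ℝ 1 F (ball 0 R) := hv.comp_contDiff hGd hGc
  have hwC : ContDiff ℝ 1 w := hv.ind_contDiff hk hF0 hFc
  have hwt := hv.tsupp hk hF0
  set S : Set (EuclideanSpace ℝ (Fin n)) := {x ∈ ball 0 R | k < v x} with hSdef
  have hSm : MeasurableSet S := by
    have : IsOpen S := hv.cont_ball.isOpen_inter_preimage isOpen_ball isOpen_Ioi
    exact this.measurableSet
  have hSf : volume S ≠ ⊤ := by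
    refine ne_top_of_le_ne_top ?_ (measure_mono (show S ⊆ ball 0 R from fun x hx => hx.1))
    exact measure_ball_lt_top.ne
  have hwS : Function.support w ⊆ S := by
    intro x hx
    have hx' : w x ≠ 0 := hx
    have hxb : x ∈ ball 0 R := by
      by_contra hc
      exact hx' (indicator_of_notMem hc _)
    refine ⟨hxb, ?_⟩
    by_contra hc
    push Not at hc
    apply hx'
    rw [hw, indicator_of_mem hxb, hF0 x hxb hc]
  set r := 2 * q / (p + q) with hr
  have hr0 : 0 < r := by positivity
  have hr1 : r < 1 := by rw [hr, div_lt_one (by positivity)]; linarith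
  have sob := hS w hwC hwt.1 r hr0 (by linarith) S hSm hSf hwS
  set Z := ∫ x in ball 0 R, v x ^ q * hh k (v x) ^ 3 with hZ
  have hvq0 : ∀ x ∈ ball 0 R, v x ≤ k → v x ^ q * hh k (v x) ^ 3 = 0 := fun x hx hxk => by
    simp [hhz (v x) ⟨hv.pos x hx, hxk⟩]
  have hmaps : MapsTo v (ball 0 R) (Ioo 0 M) := fun x hx => ⟨hv.pos x hx, hv.lt x hx⟩
  have hvqi : Integrable (indicator (ball 0 R) fun x => v x ^ q * hh k (v x) ^ 3) :=
    hv.ind_integrable hk hvq0 (((hpw q).mul (hhc.pow 3)).comp hv.cont_ball hmaps)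
  have hvqi' : IntegrableOn (fun x => v x ^ q * hh k (v x) ^ 3) (ball 0 R) :=
    (integrable_indicator_iff measurableSet_ball).1 hvqi
  have hZ0 : 0 ≤ Z := setIntegral_nonneg measurableSet_ball fun x hx =>
    mul_nonneg (Real.rpow_nonneg (hv.pos x hx).le _) (pow_nonneg (hh_nonneg _ _) _)
  -- gradient bound
  have hgrad : ∫ x, ‖fderiv ℝ w x‖ ^ 2 ≤ B * Z / t := by
    have e1 : ∫ x, ‖fderiv ℝ w x‖ ^ 2 = ∫ x in ball 0 R, ‖fderiv ℝ w x‖ ^ 2 := by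
      symm
      apply setIntegral_eq_integral_of_forall_compl_eq_zero
      intro x hx
      have : fderiv ℝ w x = 0 := by
        by_contra hc
        exact hx (hwt.2 (support_fderiv_subset ℝ hc))
      simp [this]
    have e2 : ∫ x in ball 0 R, ‖fderiv ℝ w x‖ ^ 2 ≤ ∫ x in ball 0 R, (γ + 2) ^ 2 / q *
       (v x ^ (p + q - 1 - 1) * ((p + q - 1) * hh k (v x) ^ 3 + 3 * hh k (v x) ^ 2 * (1 - hh k (v x)))
        * ‖fderiv ℝ v x‖ ^ 2) := by
      apply integral_mono_of_nonneg
      · exact Eventually.of_forall fun x => by positivity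
      · exact i2.const_mul _
      · refine (ae_restrict_iff' measurableSet_ball).2 (Eventually.of_forall fun x hx => ?_)
        have hvx := hv.pos x hx
        have f1 : fderiv ℝ w x = G' (v x) • fderiv ℝ v x := by
          rw [(Slice.ind_ev hx).fderiv_eq]
          exact (hv.comp_fderiv hGd hx).fderiv
        simp only
        rw [f1, norm_smul, mul_pow, Real.norm_eq_abs, sq_abs, ← mul_assoc]
        apply mul_le_mul_of_nonneg_right _ (by positivity)
        have g0 := hh_nonneg k (v x)
        have g1 := hh_le_one hk hvx
        simp only [hG']
        generalize hh k (v x) = h at g0 g1 ⊢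
        have b1 : (v x ^ (γ - 1)) ^ 2 = v x ^ (p + q - 1 - 1) := by
          rw [← Real.rpow_natCast, ← Real.rpow_mul hvx.le]; congr 1; rw [hγ]; push_cast; ring
        rw [mul_pow, b1]
        have hγ0 : 0 < γ := by positivity
        have b2 : 0 ≤ γ * h ^ 2 + 2 * h * (1 - h) := by
          have : 0 ≤ 1 - h := by linarith
          positivity
        have b3 : γ * h ^ 2 + 2 * h * (1 - h) ≤ (γ + 2) * h := by
          have := mul_nonneg hγ0.le (mul_nonneg g0 (sub_nonneg.2 g1))
          nlinarith
        have b4 : (γ * h ^ 2 + 2 * h * (1 - h)) ^ 2 ≤ (γ + 2) ^ 2 * h ^ 2 := by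
          rw [← mul_pow]; exact pow_le_pow_left₀ b2 b3 2
        have b5 : q * h ^ 2 ≤ (p + q - 1) * h ^ 3 + 3 * h ^ 2 * (1 - h) := by
          have c1 : 0 ≤ (p - 1) * h ^ 3 := mul_nonneg (by linarith) (by positivity)
          have c2 : 0 ≤ (3 - q) * (h ^ 2 * (1 - h)) :=
            mul_nonneg (by linarith) (mul_nonneg (by positivity) (by linarith))
          nlinarith
        calc v x ^ (p + q - 1 - 1) * (γ * h ^ 2 + 2 * h * (1 - h)) ^ 2
            ≤ v x ^ (p + q - 1 - 1) * ((γ + 2) ^ 2 * h ^ 2) := by gcongr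
          _ = (γ + 2) ^ 2 / q * (v x ^ (p + q - 1 - 1) * (q * h ^ 2)) := by field_simp
          _ ≤ _ := by gcongr
    have e3 : -∫ x in ball 0 R, v x ^ (p + q - 1) * hh k (v x) ^ 3 * lap v x ≤ Z / (p * t) := by
      rw [← integral_neg, hZ, ← integral_div]
      apply setIntegral_mono_on i1.neg (hvqi'.div_const _) measurableSet_ball
      intro x hx
      have hvx := hv.pos x hx
      have g0 := hh_nonneg k (v x)
      have := mul_le_mul_of_nonneg_left (hlap x hx)
        (show 0 ≤ v x ^ (q - 1) * hh k (v x) ^ 3 by positivity)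
      have a1 : v x ^ (p + q - 1) = v x ^ (q - 1) * v x ^ p := by
        rw [← Real.rpow_add hvx]; congr 1; ring
      have a2 : v x ^ q = v x ^ (q - 1) * v x := by
        rw [Real.rpow_sub_one hvx.ne']; field_simp
      simp only [Pi.neg_apply]
      rw [a1, a2]
      have a3 : v x ^ (q - 1) * hh k (v x) ^ 3 * (-v x / (p * t)) =
        - (v x ^ (q - 1) * v x * hh k (v x) ^ 3 / (p * t)) := by ring
      rw [a3] at this
      nlinarith
    rw [e1]
    refine e2.trans ?_
    rw [integral_const_mul]
    have : ∫ x in ball 0 R, (v x ^ (p + q - 1 - 1) * ((p + q - 1) * hh k (v x) ^ 3 + 3 * hh k (v x) ^ 2 * (1 - hh k (v x)))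
        * ‖fderiv ℝ v x‖ ^ 2) ≤ Z / (p * t) := by linarith
    calc _ ≤ (γ + 2) ^ 2 / q * (Z / (p * t)) := by gcongr
      _ = _ := by rw [hB]; field_simp
  have hZw : Z ≤ ∫ x, |w x| ^ r := by
    rw [hZ, ← integral_indicator measurableSet_ball]
    apply integral_mono hvqi
    · apply Continuous.integrable_of_hasCompactSupport
      · exact (hwC.continuous.abs).rpow_const (fun x => Or.inr hr0.le)
      · apply hwt.1.comp_left (g := fun y => |y| ^ r)
        simp [hr0.ne']
    · intro x
      by_cases hx : x ∈ ball 0 R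
      · simp only [hw, indicator_of_mem hx, hF]
        have hvx := hv.pos x hx
        have g0 := hh_nonneg k (v x)
        have g1 := hh_le_one hk hvx
        rw [abs_of_nonneg (by positivity), Real.mul_rpow (by positivity) (by positivity),
          ← Real.rpow_mul hvx.le]
        have : γ * r = q := by rw [hγ, hr]; field_simp
        rw [this]
        apply mul_le_mul_of_nonneg_left _ (by positivity)
        rw [← Real.rpow_natCast, ← Real.rpow_natCast, ← Real.rpow_mul g0]
        apply Real.rpow_le_rpow_of_exponent_ge' g0 g1 (by positivity)
        push_cast; linarith
      · simp only [hw, indicator_of_notMem hx]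
        positivity
  have hfin : Z ≤ ((A * B / t) * Z) ^ (r / 2) * volume.real S ^ (1 - r / 2 * ((n:ℝ) - 2) / n) := by
    refine hZw.trans (sob.trans ?_)
    have y1 : A * ∫ x, ‖fderiv ℝ w x‖ ^ 2 ≤ A * B / t * Z := by
      calc A * ∫ x, ‖fderiv ℝ w x‖ ^ 2 ≤ A * (B * Z / t) := mul_le_mul_of_nonneg_left hgrad hA.le
        _ = _ := by ring
    have y0 : 0 ≤ A * ∫ x, ‖fderiv ℝ w x‖ ^ 2 :=
      mul_nonneg hA.le (integral_nonneg fun x => by positivity)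
    exact mul_le_mul_of_nonneg_right (Real.rpow_le_rpow y0 y1 (by positivity)) (by positivity)
  have := solve_Z hZ0 (by positivity) measureReal_nonneg (by linarith) hfin
  refine this.trans (le_of_eq ?_)
  have hpq : p + q ≠ 0 := by positivity
  have x0 : 1 - r / 2 = p / (p + q) := by rw [hr]; field_simp; ring
  have x1 : r / 2 / (1 - r / 2) = q / p := by rw [x0, hr]; field_simp
  have x2 : (1 - r / 2 * ((n:ℝ) - 2) / n) / (1 - r / 2) = 1 + 2 * q / (n * p) := by
    rw [x0, hr]; field_simp; ring
  rw [x1, x2, Real.div_rpow (by positivity) ht.le, neg_div, Real.rpow_neg ht.le, ← div_eq_mul_inv]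

lemma ab_deriv {p : ℝ} (hp : 0 < p) {f : ℝ → ℝ} {f' t : ℝ} (ht : 0 < t)
    (hm : ∀ s s', 0 < s → s < s' → s ^ (1/p) * f s ≤ s' ^ (1/p) * f s')
    (hf : HasDerivAt f f' t) : -(f t) / (p * t) ≤ f' := by
  have h1 : HasDerivAt (fun s => s ^ (1/p) * f s) (1/p * t ^ (1/p - 1) * f t + t ^ (1/p) * f') t :=
    (Real.hasDerivAt_rpow_const (Or.inl ht.ne')).mul hf
  have h2 : MonotoneOn (fun s => s ^ (1/p) * f s) (Ioi 0) := by
    intro s hs s' hs' hss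
    rcases hss.eq_or_lt with h | h
    · rw [h]
    · exact hm s s' hs h
  have h3 := h2.derivWithin_nonneg (x := t)
  rw [derivWithin_of_isOpen isOpen_Ioi ht, h1.deriv, Real.rpow_sub_one ht.ne'] at h3
  have h4 : 1/p * (t ^ (1/p) / t) * f t + t ^ (1/p) * f' = t ^ (1/p) * (f t / (p * t) + f') := by
    field_simp
  rw [h4] at h3
  have h5 := nonneg_of_mul_nonneg_right h3 (by positivity)
  rw [neg_div]; linarith

/-- common hypotheses on a solution -/
structure GoodSol (n : ℕ) (p R M1 : ℝ) (g : EuclideanSpace ℝ (Fin n) → ℝ)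
    (u : EuclideanSpace ℝ (Fin n) → ℝ → ℝ) : Prop where
  sol : IsBallSol n p R 0 (ball 0 R) g u
  pos : ∀ x ∈ ball 0 R, ∀ t ≥ (0:ℝ), 0 < u x t
  le : ∀ x ∈ ball 0 R, ∀ t ≥ (0:ℝ), u x t ≤ M1
  ab : ∀ x ∈ ball 0 R, ∀ t t', 0 < t → t < t' → t ^ (1/p) * u x t ≤ t' ^ (1/p) * u x t'

namespace GoodSol
variable {n : ℕ} {p R M1 M : ℝ} {g : EuclideanSpace ℝ (Fin n) → ℝ}
    {u : EuclideanSpace ℝ (Fin n) → ℝ → ℝ}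

lemma slice (h : GoodSol n p R M1 g u) (hM : M1 < M) {t : ℝ} (ht : 0 < t) :
    Slice R M (fun x => u x t) where
  smooth := h.sol.2.2.2.1 t ht
  cont := h.sol.1.comp (f := fun x => (x, t)) (by fun_prop) (fun x hx => ⟨hx, ht.le⟩)
  bdry := fun x hx => h.sol.2.2.1 x hx t ht
  pos := fun x hx => h.pos x hx t ht.le
  lt := fun x hx => (h.le x hx t ht.le).trans_lt hM

lemma lap_ge (h : GoodSol n p R M1 g u) (hp : 0 < p) {x : EuclideanSpace ℝ (Fin n)}
    (hx : x ∈ ball 0 R) {t : ℝ} (ht : 0 < t) :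
    -(u x t) / (p * t) ≤ u x t ^ p * lap (fun y => u y t) x :=
  ab_deriv hp ht (h.ab x hx) (h.sol.2.2.2.2 x hx t ht)

lemma meas (h : GoodSol n p R M1 g u) :
    ∃ P : EuclideanSpace ℝ (Fin n) × ℝ → ℝ, Measurable P ∧ ∀ x ∈ ball 0 R, ∀ t > 0,
      P (x, t) = u x t ^ p * lap (fun y => u y t) x := by
  set K : Set (EuclideanSpace ℝ (Fin n) × ℝ) := closedBall 0 R ×ˢ Ici 0 with hK
  have hKc : IsClosed K := isClosed_closedBall.prod isClosed_Ici
  obtain ⟨G, hG⟩ := ContinuousMap.exists_restrict_eq hKc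
    (⟨K.restrict (fun z => u z.1 z.2), h.sol.1.restrict⟩ : C(K, ℝ))
  have hGe : ∀ z ∈ K, G z = u z.1 z.2 := fun z hz => by
    have := DFunLike.congr_fun hG ⟨z, hz⟩
    exact this
  refine ⟨fun z => deriv (fun τ => G (z.1, τ)) z.2, ?_, ?_⟩
  · exact measurable_deriv_with_param (f := fun x τ => G (x, τ)) (by
      exact G.continuous)
  · intro x hx t ht
    have : (fun τ => G (x, τ)) =ᶠ[nhds t] fun τ => u x τ := by
      filter_upwards [lt_mem_nhds ht] with τ hτ
      exact hGe (x, τ) ⟨ball_subset_closedBall hx, le_of_lt hτ⟩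
    simp only
    rw [this.deriv_eq, (h.sol.2.2.2.2 x hx t ht).deriv]

lemma cont_x (h : GoodSol n p R M1 g u) {x : EuclideanSpace ℝ (Fin n)}
    (hx : x ∈ closedBall 0 R) : ContinuousOn (u x) (Ici 0) :=
  h.sol.1.comp (f := fun t => (x, t)) (by fun_prop) (fun t ht => ⟨hx, ht⟩)

lemma energy (h : GoodSol n p R M1 g u) (hp : 0 < p) (hM : M1 < M) {k : ℝ} (hk : 0 < k)
    {Φ Φ' ψ' : ℝ → ℝ} (hΦ : ∀ s ∈ Ioo 0 M, HasDerivAt Φ (Φ' s) s)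
    (hΦ'c : ContinuousOn Φ' (Ioo 0 M)) (hΦ'0 : ∀ s ∈ Ioo 0 M, 0 ≤ Φ' s)
    (hz : ∀ s ∈ Ioc 0 k, Φ s = 0) (hz' : ∀ s ∈ Ioc 0 k, Φ' s = 0)
    (hψ : ∀ s ∈ Ioo 0 M, HasDerivAt (fun s => s ^ p * Φ' s) (ψ' s) s)
    (hψc : ContinuousOn ψ' (Ioo 0 M)) (hψ0 : ∀ s ∈ Ioo 0 M, 0 ≤ ψ' s)
    (hψz : ∀ s ∈ Ioc 0 k, ψ' s = 0) {a b : ℝ} (ha : 0 < a) (hab : a ≤ b) :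
    ∫ x in ball 0 R, Φ (u x b) ≤ ∫ x in ball 0 R, Φ (u x a) := by
  obtain ⟨P, hPm, hP⟩ := h.meas
  have hmem : ∀ x ∈ ball 0 R, ∀ t ≥ (0:ℝ), u x t ∈ Ioo 0 M := fun x hx t ht =>
    ⟨h.pos x hx t ht, (h.le x hx t ht).trans_lt hM⟩
  obtain ⟨C0, hC00, hC0⟩ : ∃ C0 : ℝ, 0 ≤ C0 ∧ ∀ s, 0 < s → s ≤ M1 → Φ' s * s / (p * a) ≤ C0 := by
    have hc : ContinuousOn (fun s => Φ' s * s / (p * a)) (Icc k M1) :=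
      ((hΦ'c.mono fun s hs => ⟨hk.trans_le hs.1, hs.2.trans_lt hM⟩).mul continuousOn_id).div_const _
    obtain ⟨C, hC⟩ := isCompact_Icc.bddAbove_image hc
    refine ⟨max C 0, le_max_right _ _, fun s hs hs1 => ?_⟩
    rcases le_total s k with h1 | h1
    · rw [hz' s ⟨hs, h1⟩]; simp
    · exact (hC ⟨s, ⟨h1, hs1⟩, rfl⟩).trans (le_max_left _ _)
  set f' : EuclideanSpace ℝ (Fin n) × ℝ → ℝ := fun z => Φ' (u z.1 z.2) * P z with hf'
  have hlow : ∀ x ∈ ball 0 R, ∀ t ≥ a, -C0 ≤ f' (x, t) := by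
    intro x hx t ht
    have ht0 := ha.trans_le ht
    have hm := hmem x hx t ht0.le
    have h1 := h.lap_ge hp hx ht0
    simp only [hf']
    rw [hP x hx t ht0]
    have h2 := mul_le_mul_of_nonneg_left h1 (hΦ'0 _ hm)
    have h3 := hC0 _ hm.1 (h.le x hx t ht0.le)
    have h4 : Φ' (u x t) * u x t / (p * t) ≤ Φ' (u x t) * u x t / (p * a) := by
      have := mul_nonneg (hΦ'0 _ hm) hm.1.le
      gcongr
    have h5 : Φ' (u x t) * (-(u x t) / (p * t)) = -(Φ' (u x t) * u x t / (p * t)) := by ring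
    linarith
  have hder : ∀ x ∈ ball 0 R, ∀ t > 0, HasDerivAt (fun τ => Φ (u x τ)) (f' (x, t)) t := by
    intro x hx t ht
    simp only [hf']
    rw [hP x hx t ht]
    exact (hΦ _ (hmem x hx t ht.le)).comp t (h.sol.2.2.2.2 x hx t ht)
  have hcont : ∀ x ∈ ball 0 R, ContinuousOn (fun τ => Φ (u x τ)) (Icc a b) := fun x hx t ht =>
    (hder x hx t (ha.trans_le ht.1)).continuousAt.continuousWithinAt
  have hIntg : ∀ x ∈ ball 0 R, IntegrableOn (fun t => f' (x, t)) (Ioc a b) := by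
    intro x hx
    have h1 : IntegrableOn (fun t => f' (x, t) + C0) (Ioc a b) := by
      apply intervalIntegral.integrableOn_deriv_of_nonneg (g := fun t => Φ (u x t) + C0 * t)
      · exact (hcont x hx).add (by fun_prop)
      · intro t ht
        have := (hder x hx t (ha.trans ht.1)).add ((hasDerivAt_id t).const_mul C0)
        simp only [mul_one] at this
        exact this
      · intro t ht
        have := hlow x hx t ht.1.le
        linarith
    have h2 : IntegrableOn (fun _ : ℝ => C0) (Ioc a b) := by simp
    have := h1.sub h2
    refine this.congr (Eventually.of_forall fun t => ?_)
    simp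
  have hftc : ∀ x ∈ ball 0 R, ∫ t in Ioc a b, f' (x, t) = Φ (u x b) - Φ (u x a) := by
    intro x hx
    rw [← intervalIntegral.integral_of_le hab]
    apply intervalIntegral.integral_eq_sub_of_hasDerivAt_of_le hab (hcont x hx)
    · intro t ht
      exact hder x hx t (ha.trans ht.1)
    · rw [intervalIntegrable_iff_integrableOn_Ioc_of_le hab]
      exact hIntg x hx
  have hΦi : ∀ t > 0, IntegrableOn (fun x => Φ (u x t)) (ball 0 R) := by
    intro t ht
    have hs := h.slice hM ht
    have := hs.ind_integrable hk (F := fun x => Φ (u x t))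
      (fun x hx hxk => hz _ ⟨h.pos x hx t ht.le, hxk⟩)
      ((hs.comp_contDiff hΦ hΦ'c).continuousOn)
    exact (integrable_indicator_iff measurableSet_ball).1 this
  set μ := (volume : Measure (EuclideanSpace ℝ (Fin n))).restrict (ball 0 R) with hμ
  have : IsFiniteMeasure μ := ⟨by simpa [hμ] using measure_ball_lt_top⟩
  set ν := (volume : Measure ℝ).restrict (Ioc a b) with hν
  have : IsFiniteMeasure ν := ⟨by simp [hν]⟩
  have hmeas : AEStronglyMeasurable f' (μ.prod ν) := by
    rw [hμ, hν, Measure.prod_restrict]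
    apply AEStronglyMeasurable.mul _ hPm.aestronglyMeasurable
    apply ContinuousOn.aestronglyMeasurable _ (measurableSet_ball.prod measurableSet_Ioc)
    apply hΦ'c.comp
    · exact h.sol.1.mono fun z hz => ⟨ball_subset_closedBall hz.1, ha.le.trans hz.2.1.le⟩
    · intro z hz
      exact hmem z.1 hz.1 z.2 (ha.le.trans hz.2.1.le)
  have hboth : ∀ᵐ z ∂(μ.prod ν), z.1 ∈ ball 0 R ∧ z.2 ∈ Ioc a b := by
    rw [hμ, hν, Measure.prod_restrict]
    filter_upwards [ae_restrict_mem (measurableSet_ball.prod measurableSet_Ioc)] with z hz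
    exact ⟨hz.1, hz.2⟩
  have hI : Integrable (fun z => f' z + C0) (μ.prod ν) := by
    have hmm : AEStronglyMeasurable (fun z => f' z + C0) (μ.prod ν) :=
      hmeas.add aestronglyMeasurable_const
    rw [integrable_prod_iff hmm]
    constructor
    · filter_upwards [ae_restrict_mem measurableSet_ball] with x hx
      exact (hIntg x hx).add (integrable_const _)
    · have h1 : Integrable (fun x => Φ (u x b) - Φ (u x a) + C0 * (b - a)) μ :=
        ((hΦi b (ha.trans_le hab)).sub (hΦi a ha)).add (integrable_const _)
      refine h1.congr ?_
      filter_upwards [ae_restrict_mem measurableSet_ball] with x hx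
      have e1 : ∫ t, ‖f' (x, t) + C0‖ ∂ν = ∫ t, (f' (x, t) + C0) ∂ν := by
        apply integral_congr_ae
        filter_upwards [ae_restrict_mem measurableSet_Ioc] with t ht
        rw [Real.norm_of_nonneg]
        have := hlow x hx t ht.1.le
        linarith
      rw [e1, integral_add (hIntg x hx) (integrable_const _), hftc x hx]
      simp [hν, hab, mul_comm]
  have hI' : Integrable f' (μ.prod ν) := by
    have := hI.sub (integrable_const C0)
    refine this.congr (Eventually.of_forall fun t => ?_)
    simp
  have hswap := integral_integral_swap (f := fun x t => f' (x, t)) hI'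
  have hneg : ∫ t, ∫ x, f' (x, t) ∂μ ∂ν ≤ 0 := by
    apply integral_nonpos_of_ae
    filter_upwards [ae_restrict_mem measurableSet_Ioc] with t ht
    have ht0 : 0 < t := ha.trans ht.1
    have hs := h.slice hM ht0
    obtain ⟨j1, j2, j3⟩ := hs.ibp hk hψ hψc (fun s hs => by simp [hz' s hs]) hψz
    have e1 : ∫ x, f' (x, t) ∂μ = ∫ x in ball 0 R, u x t ^ p * Φ' (u x t) * lap (fun y => u y t) x := by
      apply setIntegral_congr_fun measurableSet_ball
      intro x hx
      simp only [hf']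
      rw [hP x hx t ht0]; ring
    simp only [Pi.zero_apply]
    rw [e1, j3, neg_nonpos]
    apply setIntegral_nonneg measurableSet_ball
    intro x hx
    exact mul_nonneg (hψ0 _ (hmem x hx t ht0.le)) (by positivity)
  have hL : ∫ x, ∫ t, f' (x, t) ∂ν ∂μ = (∫ x in ball 0 R, Φ (u x b)) - ∫ x in ball 0 R, Φ (u x a) := by
    rw [← integral_sub (hΦi b (ha.trans_le hab)) (hΦi a ha)]
    apply setIntegral_congr_fun measurableSet_ball
    intro x hx
    exact hftc x hx
  rw [hL] at hswap
  linarith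

end GoodSol

/-- derivative of the truncated identity -/
noncomputable def eta (c y : ℝ) : ℝ := 3 * hh c y ^ 2 - 2 * hh c y ^ 3

lemma eta_nonneg {c y : ℝ} (hc : 0 < c) (hy : 0 < y) : 0 ≤ eta c y := by
  have h0 := hh_nonneg c y
  have h1 := hh_le_one hc hy
  unfold eta
  nlinarith [mul_nonneg (sq_nonneg (hh c y)) (sub_nonneg.2 h1), sq_nonneg (hh c y)]

lemma H_deriv {c y : ℝ} (hy : 0 < y) : HasDerivAt (fun y => y * hh c y ^ 3) (eta c y) y := by
  have h := psi_deriv (k := c) hy 1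
  simp only [Real.rpow_one, sub_self, Real.rpow_zero] at h
  convert! h using 1
  unfold eta; ring

lemma eta_deriv {c y : ℝ} (hy : 0 < y) :
    HasDerivAt (eta c) ((6 * hh c y - 6 * hh c y ^ 2) * (c / y ^ 2)) y := by
  have h := ((hh_sq_deriv (k := c) hy).const_mul 3).sub ((hh_cube_deriv (k := c) hy).const_mul 2)
  convert! h using 1
  ring

lemma eta_cont (c : ℝ) : ContinuousOn (eta c) (Ioi 0) := fun _ hy =>
  (eta_deriv hy).continuousAt.continuousWithinAt

namespace GoodSol
variable {n : ℕ} {p R M1 M : ℝ} {g : EuclideanSpace ℝ (Fin n) → ℝ}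
    {u : EuclideanSpace ℝ (Fin n) → ℝ → ℝ}

lemma energyL (h : GoodSol n p R M1 g u) (hp : 1 ≤ p) {q₀ s₀ : ℝ} (hq₀ : 0 < q₀) (hs₀ : 0 < s₀)
    {L L' L'' : ℝ → ℝ} (hLcont : ContinuousOn L (Ici 0)) (hL0 : L 0 = 0)
    (hLderiv : ∀ s ∈ Ioo 0 s₀, HasDerivAt L (L' s) s)
    (hL'deriv : ∀ s ∈ Ioo 0 s₀, HasDerivAt L' (L'' s) s)
    (hL''cont : ContinuousOn L'' (Ioo 0 s₀))
    (hLpos : ∀ s ∈ Ioi (0:ℝ), 0 < L s)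
    (hLmono : MonotoneOn L (Ioi 0))
    (hLconv : ∀ s ∈ Ioo 0 s₀, s * L'' s ≥ -((3*p + q₀ - 2)/(p + q₀)) * L' s)
    (hM : M1 < s₀ ^ (2 / (p + q₀))) {c : ℝ} (hc : 0 < c) {a b : ℝ} (ha : 0 < a) (hab : a ≤ b) :
    ∫ x in ball 0 R, L (u x b ^ ((p + q₀) / 2)) * hh c (L (u x b ^ ((p + q₀) / 2))) ^ 3 ≤
    ∫ x in ball 0 R, L (u x a ^ ((p + q₀) / 2)) * hh c (L (u x a ^ ((p + q₀) / 2))) ^ 3 := by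
  set β := (p + q₀) / 2 with hβ
  have hβ0 : 0 < β := by positivity
  set M := s₀ ^ (2 / (p + q₀)) with hMdef
  have hMβ : M ^ β = s₀ := by
    rw [hMdef, ← Real.rpow_mul hs₀.le]
    have : 2 / (p + q₀) * β = 1 := by rw [hβ]; field_simp
    rw [this, Real.rpow_one]
  have hmap : ∀ s ∈ Ioo 0 M, s ^ β ∈ Ioo 0 s₀ := fun s hs =>
    ⟨Real.rpow_pos_of_pos hs.1 _, by rw [← hMβ]; exact Real.rpow_lt_rpow hs.1.le hs.2 hβ0⟩
  have hL'0 : ∀ s ∈ Ioo 0 s₀, 0 ≤ L' s := fun s hs => by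
    have := hLmono.derivWithin_nonneg (x := s)
    rwa [derivWithin_of_isOpen isOpen_Ioi hs.1, (hLderiv s hs).deriv] at this
  have hlpos : ∀ s ∈ Ioo 0 M, 0 < L (s ^ β) := fun s hs => hLpos _ (hmap s hs).1
  -- small k
  obtain ⟨k, hk, hkc⟩ : ∃ k > 0, ∀ s ∈ Ioc 0 k, L (s ^ β) ≤ c := by
    have h1 : Tendsto L (nhdsWithin 0 (Ici 0)) (nhds 0) := by
      have := hLcont 0 (by simp)
      rwa [ContinuousWithinAt, hL0] at this
    have h2 : ∀ᶠ y in nhdsWithin 0 (Ioi 0), L y < c :=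
      (h1.mono_left (nhdsWithin_mono _ Ioi_subset_Ici_self)) (gt_mem_nhds hc)
    obtain ⟨y, hy, hy0⟩ := (h2.and self_mem_nhdsWithin).exists
    have hy0 : 0 < y := hy0
    refine ⟨y ^ (1/β), by positivity, fun s hs => ?_⟩
    have h3 : s ^ β ≤ y := by
      calc s ^ β ≤ (y ^ (1/β)) ^ β := Real.rpow_le_rpow hs.1.le hs.2 hβ0.le
        _ = y := by rw [← Real.rpow_mul hy0.le, one_div_mul_cancel hβ0.ne', Real.rpow_one]
    exact (hLmono (Real.rpow_pos_of_pos hs.1 _) hy0 h3).trans hy.le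
  have hkz : ∀ s ∈ Ioc 0 k, hh c (L (s ^ β)) = 0 := fun s hs =>
    hh_zero (hLpos _ (Real.rpow_pos_of_pos hs.1 _)) (hkc s hs)
  have hpw : ∀ e : ℝ, ContinuousOn (fun s : ℝ => s ^ e) (Ioo 0 M) := fun e s hs =>
    (Real.continuousAt_rpow_const s e (Or.inl hs.1.ne')).continuousWithinAt
  have hpd : ∀ (e : ℝ), ∀ s ∈ Ioo 0 M, HasDerivAt (fun s : ℝ => s ^ e) (e * s ^ (e - 1)) s :=
    fun e s hs => Real.hasDerivAt_rpow_const (Or.inl hs.1.ne')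
  have hld : ∀ s ∈ Ioo 0 M, HasDerivAt (fun s => L (s ^ β)) (L' (s ^ β) * (β * s ^ (β - 1))) s :=
    fun s hs => (hLderiv _ (hmap s hs)).comp s (hpd β s hs)
  have hl'd : ∀ s ∈ Ioo 0 M, HasDerivAt (fun s => L' (s ^ β)) (L'' (s ^ β) * (β * s ^ (β - 1))) s :=
    fun s hs => (hL'deriv _ (hmap s hs)).comp s (hpd β s hs)
  have hlc : ContinuousOn (fun s => L (s ^ β)) (Ioo 0 M) := fun s hs =>
    (hld s hs).continuousAt.continuousWithinAt
  have hl'c : ContinuousOn (fun s => L' (s ^ β)) (Ioo 0 M) := fun s hs =>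
    (hl'd s hs).continuousAt.continuousWithinAt
  have hl''c : ContinuousOn (fun s => L'' (s ^ β)) (Ioo 0 M) := hL''cont.comp (hpw β) hmap
  have hhlc : ContinuousOn (fun s => hh c (L (s ^ β))) (Ioo 0 M) := (hh_cont c).comp hlc hlpos
  have hetac : ContinuousOn (fun s => eta c (L (s ^ β))) (Ioo 0 M) := (eta_cont c).comp hlc hlpos
  set ρ' : ℝ → ℝ := fun s => β * s ^ (p + β - 2) * ((p + β - 1) * L' (s ^ β) + β * (s ^ β * L'' (s ^ β)))
    with hρ'
  have hρ'0 : ∀ s ∈ Ioo 0 M, 0 ≤ ρ' s := by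
    intro s hs
    have h1 := hLconv _ (hmap s hs)
    have h2 : β * ((3*p + q₀ - 2)/(p + q₀)) = p + β - 1 := by rw [hβ]; field_simp; ring
    have h3 := mul_le_mul_of_nonneg_left h1 hβ0.le
    have h4 : 0 < s := hs.1
    apply mul_nonneg (by positivity)
    have h5 : β * (-((3*p + q₀ - 2)/(p + q₀)) * L' (s ^ β)) = -((p + β - 1) * L' (s ^ β)) := by
      rw [← h2]; ring
    linarith
  refine h.energy (by linarith) hM hk (Φ := fun s => L (s ^ β) * hh c (L (s ^ β)) ^ 3)
    (Φ' := fun s => eta c (L (s ^ β)) * (L' (s ^ β) * (β * s ^ (β - 1))))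
    (ψ' := fun s => ((6 * hh c (L (s ^ β)) - 6 * hh c (L (s ^ β)) ^ 2) * (c / L (s ^ β) ^ 2)) *
        (L' (s ^ β) * (β * s ^ (β - 1))) * (β * s ^ (p + β - 1) * L' (s ^ β))
        + eta c (L (s ^ β)) * ρ' s) ?_ ?_ ?_ ?_ ?_ ?_ ?_ ?_ ?_ ha hab
  · intro s hs
    exact (H_deriv (hlpos s hs)).comp s (hld s hs)
  · exact hetac.mul (hl'c.mul ((hpw _).const_mul _))
  · intro s hs
    have h4 : 0 < s := hs.1
    have := eta_nonneg hc (hlpos s hs)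
    have := hL'0 _ (hmap s hs)
    positivity
  · intro s hs; simp [hkz s hs]
  · intro s hs; simp [eta, hkz s hs]
  · intro s hs
    have hρ : HasDerivAt (fun s => β * s ^ (p + β - 1) * L' (s ^ β)) (ρ' s) s := by
      have := ((hpd (p + β - 1) s hs).const_mul β).mul (hl'd s hs)
      convert! this using 1
      simp only [hρ']
      have e1 : s ^ (p + β - 1 - 1) = s ^ (p + β - 2) := by congr 1; ring
      have e2 : s ^ (p + β - 1) * s ^ (β - 1) = s ^ (p + β - 2) * s ^ β := by
        rw [← Real.rpow_add hs.1, ← Real.rpow_add hs.1]; congr 1; ring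
      rw [e1]
      linear_combination (-β * β * L'' (s ^ β)) * e2
    have h1 := ((eta_deriv (c := c) (hlpos s hs)).comp s (hld s hs)).mul hρ
    have h2 := h1.congr_of_eventuallyEq (f₁ := fun s => s ^ p * (eta c (L (s ^ β)) * (L' (s ^ β) * (β * s ^ (β - 1))))) (by
      filter_upwards [isOpen_Ioo.mem_nhds hs] with y hy
      simp only [Pi.mul_apply, Function.comp]
      have e2 : y ^ (p + β - 1) = y ^ p * y ^ (β - 1) := by
        rw [← Real.rpow_add hy.1]; congr 1; ring
      rw [e2]; ring)
    exact h2
  · refine ContinuousOn.add (ContinuousOn.mul (ContinuousOn.mul (ContinuousOn.mul ?_ ?_) ?_) ?_) (hetac.mul ?_)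
    · exact (hhlc.const_mul _).sub ((hhlc.pow 2).const_mul _)
    · exact continuousOn_const.div (hlc.pow 2) fun s hs => by have := hlpos s hs; positivity
    · exact hl'c.mul ((hpw _).const_mul _)
    · exact ((hpw _).const_mul _).mul hl'c
    · exact ((hpw _).const_mul _).mul ((hl'c.const_mul _).add (((hpw _).mul hl''c).const_mul _))
  · intro s hs
    have h4 : 0 < s := hs.1
    have h5 := eta_nonneg hc (hlpos s hs)
    have h6 := hL'0 _ (hmap s hs)
    have h7 := hρ'0 s hs
    have h8 := hh_nonneg c (L (s ^ β))
    have h9 := hh_le_one hc (hlpos s hs)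
    have h10 : 0 ≤ 6 * hh c (L (s ^ β)) - 6 * hh c (L (s ^ β)) ^ 2 := by nlinarith
    positivity
  · intro s hs; simp [eta, hkz s hs]

end GoodSol

namespace GoodSol
variable {n : ℕ} {p R M1 M : ℝ} {g : EuclideanSpace ℝ (Fin n) → ℝ}
    {u : EuclideanSpace ℝ (Fin n) → ℝ → ℝ}

lemma Lcont (h : GoodSol n p R M1 g u) {β : ℝ} (hβ0 : 0 < β) {L : ℝ → ℝ}
    (hLcont : ContinuousOn L (Ici 0)) {t : ℝ} (ht : 0 ≤ t) :
    ContinuousOn (fun x => L (u x t ^ β)) (ball 0 R) := by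
  have h1 : ContinuousOn (fun x => u x t) (ball 0 R) :=
    h.sol.1.comp (f := fun x => (x, t)) (by fun_prop) (fun x hx => ⟨ball_subset_closedBall hx, ht⟩)
  exact hLcont.comp (h1.rpow_const fun x _ => Or.inr hβ0.le)
    (fun x hx => Real.rpow_nonneg (h.pos x hx t ht).le _)

lemma L_le (h : GoodSol n p R M1 g u) {β : ℝ} (hβ0 : 0 < β) {L : ℝ → ℝ}
    (hLmono : MonotoneOn L (Ioi 0)) {t : ℝ} (ht : 0 ≤ t)
    {x : EuclideanSpace ℝ (Fin n)} (hx : x ∈ ball 0 R) : L (u x t ^ β) ≤ L (M1 ^ β) := by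
  have h1 := h.pos x hx t ht
  have h2 := h.le x hx t ht
  have h3 : 0 < M1 := h1.trans_le h2
  exact hLmono (Real.rpow_pos_of_pos h1 _) (Real.rpow_pos_of_pos h3 _) (Real.rpow_le_rpow h1.le h2 hβ0.le)

lemma L_int (h : GoodSol n p R M1 g u) {β : ℝ} (hβ0 : 0 < β) {L : ℝ → ℝ}
    (hLcont : ContinuousOn L (Ici 0))  (hLpos : ∀ s ∈ Ioi (0:ℝ), 0 < L s)
    (hLmono : MonotoneOn L (Ioi 0)) {t : ℝ} (ht : 0 ≤ t) :
    IntegrableOn (fun x => L (u x t ^ β)) (ball 0 R) := by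
  have hfin : IsFiniteMeasure ((volume : Measure (EuclideanSpace ℝ (Fin n))).restrict (ball 0 R)) :=
    ⟨by simpa using measure_ball_lt_top⟩
  apply Integrable.of_bound (C := L (M1 ^ β))
    ((h.Lcont hβ0 hLcont ht).aestronglyMeasurable measurableSet_ball)
  filter_upwards [ae_restrict_mem measurableSet_ball] with x hx
  rw [Real.norm_of_nonneg (hLpos _ (Real.rpow_pos_of_pos (h.pos x hx t ht) _)).le]
  exact h.L_le hβ0 hLmono ht hx

lemma mass (h : GoodSol n p R M1 g u) (hp : 1 ≤ p) {q₀ s₀ : ℝ} (hq₀ : 0 < q₀) (hs₀ : 0 < s₀)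
    {L L' L'' : ℝ → ℝ} (hLcont : ContinuousOn L (Ici 0)) (hL0 : L 0 = 0)
    (hLderiv : ∀ s ∈ Ioo 0 s₀, HasDerivAt L (L' s) s)
    (hL'deriv : ∀ s ∈ Ioo 0 s₀, HasDerivAt L' (L'' s) s)
    (hL''cont : ContinuousOn L'' (Ioo 0 s₀))
    (hLpos : ∀ s ∈ Ioi (0:ℝ), 0 < L s)
    (hLmono : MonotoneOn L (Ioi 0))
    (hLconv : ∀ s ∈ Ioo 0 s₀, s * L'' s ≥ -((3*p + q₀ - 2)/(p + q₀)) * L' s)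
    (hM : M1 < s₀ ^ (2 / (p + q₀))) {b : ℝ} (hb : 0 < b) :
    ∫ x in ball 0 R, L (u x b ^ ((p + q₀) / 2)) ≤ ∫ x in ball 0 R, L (u x 0 ^ ((p + q₀) / 2)) := by
  have hen := fun (c : ℝ) (hc : 0 < c) (a : ℝ) (ha : 0 < a) (hab : a ≤ b) =>
    h.energyL hp hq₀ hs₀ hLcont hL0 hLderiv hL'deriv hL''cont hLpos hLmono hLconv hM hc ha hab
  set β := (p + q₀) / 2 with hβ
  have hβ0 : 0 < β := by positivity
  have hup : ∀ x ∈ ball 0 R, ∀ t ≥ (0:ℝ), 0 < L (u x t ^ β) := fun x hx t ht =>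
    hLpos _ (Real.rpow_pos_of_pos (h.pos x hx t ht) _)
  have hfin : IsFiniteMeasure ((volume : Measure (EuclideanSpace ℝ (Fin n))).restrict (ball 0 R)) :=
    ⟨by simpa using measure_ball_lt_top⟩
  -- first remove c
  have step1 : ∀ a, 0 < a → a ≤ b → ∫ x in ball 0 R, L (u x b ^ β) ≤ ∫ x in ball 0 R, L (u x a ^ β) := by
    intro a ha hab
    have hle : ∀ c, 0 < c → ∫ x in ball 0 R, L (u x b ^ β) * hh c (L (u x b ^ β)) ^ 3 ≤
        ∫ x in ball 0 R, L (u x a ^ β) := by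
      intro c hc
      refine (hen c hc a ha hab).trans ?_
      apply integral_mono_of_nonneg
      · filter_upwards [ae_restrict_mem measurableSet_ball] with x hx
        exact mul_nonneg (hup x hx a ha.le).le (pow_nonneg (hh_nonneg _ _) _)
      · exact h.L_int hβ0 hLcont hLpos hLmono ha.le
      · filter_upwards [ae_restrict_mem measurableSet_ball] with x hx
        exact mul_le_of_le_one_right (hup x hx a ha.le).le
          (pow_le_one₀ (hh_nonneg _ _) (hh_le_one hc (hup x hx a ha.le)))
    have hlim : Tendsto (fun c => ∫ x in ball 0 R, L (u x b ^ β) * hh c (L (u x b ^ β)) ^ 3)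
        (nhdsWithin 0 (Ioi 0)) (nhds (∫ x in ball 0 R, L (u x b ^ β))) := by
      apply tendsto_integral_filter_of_dominated_convergence (fun x => L (u x b ^ β))
      · filter_upwards with c
        apply ContinuousOn.aestronglyMeasurable _ measurableSet_ball
        have hc := h.Lcont hβ0 hLcont hb.le
        exact hc.mul (((hh_cont c).comp hc fun x hx => hup x hx b hb.le).pow 3)
      · filter_upwards [self_mem_nhdsWithin] with c hc
        filter_upwards [ae_restrict_mem measurableSet_ball] with x hx
        rw [Real.norm_of_nonneg (mul_nonneg (hup x hx b hb.le).le (pow_nonneg (hh_nonneg _ _) _))]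
        exact mul_le_of_le_one_right (hup x hx b hb.le).le
          (pow_le_one₀ (hh_nonneg _ _) (hh_le_one hc (hup x hx b hb.le)))
      · exact h.L_int hβ0 hLcont hLpos hLmono hb.le
      · filter_upwards [ae_restrict_mem measurableSet_ball] with x hx
        have hcc : Continuous (fun c => L (u x b ^ β) * hh c (L (u x b ^ β)) ^ 3) := by
          unfold hh; fun_prop
        have := (hcc.tendsto 0).mono_left (nhdsWithin_le_nhds (s := Ioi 0))
        simpa [hh] using this
    apply le_of_tendsto hlim
    filter_upwards [self_mem_nhdsWithin] with c hc using hle c hc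
  have hlim : Tendsto (fun a => ∫ x in ball 0 R, L (u x a ^ β))
      (nhdsWithin 0 (Ioi 0)) (nhds (∫ x in ball 0 R, L (u x 0 ^ β))) := by
    apply tendsto_integral_filter_of_dominated_convergence (fun x => L (M1 ^ β))
    · filter_upwards [self_mem_nhdsWithin] with a ha
      exact (h.Lcont hβ0 hLcont (le_of_lt ha)).aestronglyMeasurable measurableSet_ball
    · filter_upwards [self_mem_nhdsWithin] with a ha
      filter_upwards [ae_restrict_mem measurableSet_ball] with x hx
      rw [Real.norm_of_nonneg (hup x hx a (le_of_lt ha)).le]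
      exact h.L_le hβ0 hLmono (le_of_lt ha) hx
    · exact integrable_const _
    · filter_upwards [ae_restrict_mem measurableSet_ball] with x hx
      have h1 : ContinuousOn (fun a => L (u x a ^ β)) (Ici 0) :=
        hLcont.comp ((h.cont_x (ball_subset_closedBall hx)).rpow_const fun x _ => Or.inr hβ0.le)
          (fun t ht => Real.rpow_nonneg (h.pos x hx t ht).le _)
      exact (h1 0 (by simp)).mono_left (nhdsWithin_mono _ Ioi_subset_Ici_self)
  apply ge_of_tendsto hlim
  filter_upwards [Ioc_mem_nhdsGT hb] with a ha using step1 a ha.1 ha.2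

end GoodSol

lemma H_iter {L : ℝ → ℝ} {s₀ : ℝ} 
    (hLmono : MonotoneOn L (Ioi 0)) (hLpos : ∀ s ∈ Ioi (0:ℝ), 0 < L s)
    (hH : ∃ a > 0, ∃ lam₀ > 0, ∀ s ∈ Set.Ioo 0 s₀, ∀ l ∈ Set.Ioo 0 lam₀,
      L s ≤ (1 + a * l) * L (s ^ (1 + l))) (κ : ℝ) :
    ∃ C : ℝ, 0 < C ∧ ∀ s, 0 < s → s < 1 → s < s₀ → L s ≤ C * L (s ^ κ) := by
  obtain ⟨a, ha, l₀, hl₀, hH⟩ := hH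
  set l := l₀ / 2 with hl
  have hl0 : 0 < l := by positivity
  have hll : l < l₀ := by rw [hl]; linarith
  have hit : ∀ m : ℕ, ∀ s, 0 < s → s < 1 → s < s₀ → L s ≤ (1 + a * l) ^ m * L (s ^ ((1 + l) ^ m)) := by
    intro m
    induction m with
    | zero => intro s _ _ _; simp
    | succ m ih =>
      intro s hs hs1 hs0
      have h1 := ih s hs hs1 hs0
      have hp : 0 < s ^ ((1 + l) ^ m) := Real.rpow_pos_of_pos hs _
      have hle : s ^ ((1 + l) ^ m) ≤ s := by
        conv_rhs => rw [← Real.rpow_one s]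
        exact Real.rpow_le_rpow_of_exponent_ge hs hs1.le (one_le_pow₀ (by linarith))
      have h2 := hH _ ⟨hp, hle.trans_lt hs0⟩ l ⟨hl0, hll⟩
      rw [← Real.rpow_mul hs.le, ← pow_succ] at h2
      calc L s ≤ _ := h1
        _ ≤ (1 + a * l) ^ m * ((1 + a * l) * L (s ^ ((1 + l) ^ (m+1)))) := by gcongr
        _ = _ := by ring
  obtain ⟨m, hm⟩ := pow_unbounded_of_one_lt κ (show 1 < 1 + l by linarith)
  refine ⟨(1 + a * l) ^ m, by positivity, fun s hs hs1 hs0 => (hit m s hs hs1 hs0).trans ?_⟩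
  have : L (s ^ ((1 + l) ^ m)) ≤ L (s ^ κ) :=
    hLmono (Real.rpow_pos_of_pos hs _) (Real.rpow_pos_of_pos hs _)
      (Real.rpow_le_rpow_of_exponent_ge hs hs1.le hm.le)
  gcongr

lemma H_slow {L : ℝ → ℝ} {s₀ : ℝ} (hs₀ : 0 < s₀)
    (hLpos : ∀ s ∈ Ioi (0:ℝ), 0 < L s)
    (hH : ∃ a > 0, ∃ lam₀ > 0, ∀ s ∈ Set.Ioo 0 s₀, ∀ l ∈ Set.Ioo 0 lam₀,
      L s ≤ (1 + a * l) * L (s ^ (1 + l))) {η : ℝ} (hη : 0 < η) :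
    ∃ d : ℝ, 0 < d ∧ d < 1 ∧ d < s₀ ∧ ∀ s δ, 0 < s → s ≤ δ → δ ≤ d →
      L δ * s ^ η ≤ L s * δ ^ η := by
  obtain ⟨a, ha, l₀, hl₀, hH⟩ := hH
  set d := min (exp (-(a/η))) (s₀ / 2) with hd
  have hd0 : 0 < d := lt_min (exp_pos _) (by positivity)
  have hd1 : d < 1 := (min_le_left _ _).trans_lt (by rw [exp_lt_one_iff]; have : 0 < a/η := by positivity
                                                     linarith)
  have hds : d < s₀ := (min_le_right _ _).trans_lt (by linarith)
  refine ⟨d, hd0, hd1, hds, ?_⟩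
  -- one step
  have step : ∀ s, 0 < s → s ≤ d → ∀ l, 0 < l → l < l₀ →
      L s * (s ^ (1 + l)) ^ η ≤ L (s ^ (1 + l)) * s ^ η := by
    intro s hs hsd l hl hll
    have h1 := hH s ⟨hs, hsd.trans_lt hds⟩ l ⟨hl, hll⟩
    have hlog : log s ≤ -(a/η) := by
      rw [Real.log_le_iff_le_exp hs]
      exact hsd.trans (min_le_left _ _)
    have hlog' : a ≤ - (log s * η) := by
      have := mul_le_mul_of_nonneg_right hlog hη.le
      have e : -(a/η) * η = -a := by field_simp
      linarith
    have h2 : (1 + a * l) * (s ^ (1 + l)) ^ η ≤ s ^ η := by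
      rw [← Real.rpow_mul hs.le]
      have e : s ^ ((1 + l) * η) = s ^ η * exp (log s * η * l) := by
        rw [show (1 + l) * η = η + η * l by ring, Real.rpow_add hs, Real.rpow_def_of_pos hs (η * l)]
        congr 2; ring
      rw [e]
      have h3 : 1 + a * l ≤ exp (-(log s * η * l)) := by
        calc 1 + a * l ≤ exp (a * l) := by linarith [add_one_le_exp (a * l)]
          _ ≤ _ := by
            apply exp_le_exp.2
            have := mul_le_mul_of_nonneg_right hlog' hl.le
            linarith
      have h4 : (1 + a * l) * exp (log s * η * l) ≤ 1 := by
        calc _ ≤ exp (-(log s * η * l)) * exp (log s * η * l) := by gcongr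
          _ = 1 := by rw [← exp_add]; simp
      have : 0 < s ^ η := by positivity
      nlinarith
    have hp : 0 < s ^ (1 + l) := Real.rpow_pos_of_pos hs _
    have hp' := hLpos _ hp
    calc L s * (s ^ (1 + l)) ^ η ≤ (1 + a * l) * L (s ^ (1 + l)) * (s ^ (1 + l)) ^ η := by gcongr
      _ = L (s ^ (1 + l)) * ((1 + a * l) * (s ^ (1 + l)) ^ η) := by ring
      _ ≤ _ := by gcongr
  have hit : ∀ l, 0 < l → l < l₀ → ∀ m : ℕ, ∀ s, 0 < s → s ≤ d → 
      L s * (s ^ ((1 + l) ^ m)) ^ η ≤ L (s ^ ((1 + l) ^ m)) * s ^ η := by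
    intro l hl hll m
    induction m with
    | zero => intro s _ _; simp
    | succ m ih =>
      intro s hs hsd
      have h1 := ih s hs hsd
      set y := s ^ ((1 + l) ^ m) with hy
      have hp : 0 < y := Real.rpow_pos_of_pos hs _
      have hle : y ≤ s := by
        conv_rhs => rw [← Real.rpow_one s]
        exact Real.rpow_le_rpow_of_exponent_ge hs (hsd.trans hd1.le) (one_le_pow₀ (by linarith))
      have h2 := step y hp (hle.trans hsd) l hl hll
      have e : y ^ (1 + l) = s ^ ((1 + l) ^ (m + 1)) := by
        rw [hy, ← Real.rpow_mul hs.le, ← pow_succ]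
      rw [e] at h2
      set z := s ^ ((1 + l) ^ (m + 1)) with hz
      have hz0 : 0 < z := Real.rpow_pos_of_pos hs _
      have hyη : 0 < y ^ η := by positivity
      have hzη : 0 < z ^ η := by positivity
      have hsη : 0 < s ^ η := by positivity
      have h3 : (L s * z ^ η) * y ^ η ≤ (L z * s ^ η) * y ^ η := by
        calc (L s * z ^ η) * y ^ η = (L s * y ^ η) * z ^ η := by ring
          _ ≤ (L y * s ^ η) * z ^ η := by gcongr
          _ = (L y * z ^ η) * s ^ η := by ring
          _ ≤ (L z * y ^ η) * s ^ η := by gcongr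
          _ = _ := by ring
      exact le_of_mul_le_mul_right h3 hyη
  intro s δ hs hsδ hδd
  have hδ : 0 < δ := hs.trans_le hsδ
  rcases hsδ.eq_or_lt with he | hlt
  · rw [he]
  have hlδ : log δ < 0 := Real.log_neg hδ (hδd.trans_lt hd1)
  have hls : log s < log δ := Real.log_lt_log hs hlt
  set κ := log s / log δ with hκ
  have hκ1 : 1 < κ := by rw [hκ, lt_div_iff_of_neg hlδ]; linarith
  have hs' : δ ^ κ = s := by
    rw [Real.rpow_def_of_pos hδ, hκ, mul_div_cancel₀ _ hlδ.ne, Real.exp_log hs]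
  obtain ⟨m, hm⟩ := pow_unbounded_of_one_lt κ (show 1 < 1 + l₀ by linarith)
  have hm0 : m ≠ 0 := by
    rintro rfl
    simp at hm; linarith
  have hm0' : (0:ℝ) < m := by positivity
  have hpow : (κ ^ (1 / (m:ℝ))) ^ m = κ := by
    rw [← Real.rpow_natCast, ← Real.rpow_mul (by linarith), one_div_mul_cancel hm0'.ne', Real.rpow_one]
  have hgt : 1 < κ ^ (1 / (m:ℝ)) := Real.one_lt_rpow hκ1 (by positivity)
  have hlt' : κ ^ (1 / (m:ℝ)) < 1 + l₀ := by
    by_contra hc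
    push Not at hc
    have := pow_le_pow_left₀ (by linarith) hc m
    rw [hpow] at this; linarith
  have := hit (κ ^ (1 / (m:ℝ)) - 1) (by linarith) (by linarith) m δ hδ hδd
  rw [add_sub_cancel, hpow, hs'] at this
  exact this

lemma L_pow_le {L : ℝ → ℝ} {s₀ : ℝ} (hs₀ : 0 < s₀)
    (hLmono : MonotoneOn L (Ioi 0)) (hLpos : ∀ s ∈ Ioi (0:ℝ), 0 < L s)
    (hH : ∃ a > 0, ∃ lam₀ > 0, ∀ s ∈ Set.Ioo 0 s₀, ∀ l ∈ Set.Ioo 0 lam₀,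
      L s ≤ (1 + a * l) * L (s ^ (1 + l))) {β : ℝ} (hβ : 0 < β) :
    ∃ C : ℝ, 0 < C ∧ ∀ s, 0 < s → s ^ β < s₀ → L (s ^ β) ≤ C * L s := by
  obtain ⟨C, hC, hCL⟩ := H_iter hLmono hLpos hH (1/β)
  have h1 : 0 < L 1 := hLpos 1 (by simp)
  have h2 : 0 < L s₀ := hLpos s₀ hs₀
  refine ⟨C + L s₀ / L 1 + 1, by positivity, fun s hs hss => ?_⟩
  have hs' : 0 < L s := hLpos s hs
  have hp : 0 < s ^ β := Real.rpow_pos_of_pos hs _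
  have hq : 0 < L s₀ / L 1 := by positivity
  rcases le_or_gt 1 s with h | h
  · have a1 : L (s ^ β) ≤ L s₀ := hLmono hp hs₀ hss.le
    have a2 : L 1 ≤ L s := hLmono (by simp) hs h
    calc L (s ^ β) ≤ L s₀ / L 1 * L 1 := by rw [div_mul_cancel₀ _ h1.ne']; exact a1
      _ ≤ L s₀ / L 1 * L s := by gcongr
      _ ≤ _ := by gcongr; linarith
  · have a0 : s ^ β < 1 := Real.rpow_lt_one hs.le h hβ
    have := hCL (s ^ β) hp a0 hss
    rw [← Real.rpow_mul hs.le, mul_one_div_cancel hβ.ne', Real.rpow_one] at this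
    refine this.trans ?_
    gcongr; linarith

lemma S_bound {n : ℕ} {R M β k K : ℝ} {v : EuclideanSpace ℝ (Fin n) → ℝ} (hv : Slice R M v)
    (hβ : 0 < β) (hk : 0 < k) {L : ℝ → ℝ} (hLmono : MonotoneOn L (Ioi 0))
    (hLpos : ∀ s ∈ Ioi (0:ℝ), 0 < L s)
    (hIntg : IntegrableOn (fun x => L (v x ^ β)) (ball 0 R))
    (hK : ∫ x in ball 0 R, L (v x ^ β) ≤ K) :
    volume.real {x ∈ ball 0 R | k < v x} ≤ K / L (k ^ β) := by
  have hkβ : 0 < k ^ β := by positivity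
  rw [le_div_iff₀ (hLpos _ hkβ)]
  set S : Set (EuclideanSpace ℝ (Fin n)) := {x ∈ ball 0 R | k < v x} with hSdef
  have hSm : MeasurableSet S := by
    have : IsOpen S := hv.cont_ball.isOpen_inter_preimage isOpen_ball isOpen_Ioi
    exact this.measurableSet
  have hSb : S ⊆ ball 0 R := fun x hx => hx.1
  have hSf : volume S ≠ ⊤ := ne_top_of_le_ne_top measure_ball_lt_top.ne (measure_mono hSb)
  refine le_trans ?_ hK
  calc volume.real S * L (k ^ β) = ∫ x in S, L (k ^ β) := by simp
    _ ≤ ∫ x in S, L (v x ^ β) := by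
        apply setIntegral_mono_on _ (hIntg.mono_set hSb) hSm
        · intro x hx
          have := hv.pos x hx.1
          exact hLmono hkβ (Real.rpow_pos_of_pos this _) (Real.rpow_le_rpow hk.le hx.2.le hβ.le)
        · exact integrableOn_const hSf
    _ ≤ ∫ x in ball 0 R, L (v x ^ β) := by
        apply setIntegral_mono_set hIntg _ hSb.eventuallyLE
        filter_upwards [ae_restrict_mem measurableSet_ball] with x hx
        exact (hLpos _ (Real.rpow_pos_of_pos (hv.pos x hx) _)).le

lemma split_bound {n : ℕ} {R M β k K q : ℝ} {v : EuclideanSpace ℝ (Fin n) → ℝ} (hv : Slice R M v)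
    (hβ : 0 < β) (hk : 0 < k) (hq : 0 < q) {L : ℝ → ℝ}
    (hLpos : ∀ s ∈ Ioi (0:ℝ), 0 < L s)
    (hIntg : IntegrableOn (fun x => L (v x ^ β)) (ball 0 R))
    (hK : ∫ x in ball 0 R, L (v x ^ β) ≤ K)
    (hslow : ∀ s, 0 < s → s ≤ (2 * k) ^ β → L ((2 * k) ^ β) * s ^ (q/β) ≤ L s * ((2 * k) ^ β) ^ (q/β)) :
    ∫ x in ball 0 R, |v x| ^ q ≤ (2 * k) ^ q / L ((2 * k) ^ β) * K
      + 8 * ∫ x in ball 0 R, v x ^ q * hh k (v x) ^ 3 := by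
  have hhz : ∀ s ∈ Ioc 0 k, hh k s = 0 := fun s hs => hh_zero hs.1 hs.2
  have hhc : ContinuousOn (hh k) (Ioo 0 M) := (hh_cont k).mono (fun s hs => hs.1)
  have hpw : ContinuousOn (fun s : ℝ => s ^ q) (Ioo 0 M) := fun s hs =>
    (Real.continuousAt_rpow_const s q (Or.inl hs.1.ne')).continuousWithinAt
  have hvq0 : ∀ x ∈ ball 0 R, v x ≤ k → v x ^ q * hh k (v x) ^ 3 = 0 := fun x hx hxk => by
    simp [hhz (v x) ⟨hv.pos x hx, hxk⟩]
  have hmaps : MapsTo v (ball 0 R) (Ioo 0 M) := fun x hx => ⟨hv.pos x hx, hv.lt x hx⟩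
  have hvqi : Integrable (indicator (ball 0 R) fun x => v x ^ q * hh k (v x) ^ 3) :=
    hv.ind_integrable hk hvq0 ((hpw.mul (hhc.pow 3)).comp hv.cont_ball hmaps)
  have hvqi' : IntegrableOn (fun x => v x ^ q * hh k (v x) ^ 3) (ball 0 R) :=
    (integrable_indicator_iff measurableSet_ball).1 hvqi
  have h2k : 0 < (2 * k) ^ β := by positivity
  have hL2 := hLpos _ h2k
  calc ∫ x in ball 0 R, |v x| ^ q ≤ ∫ x in ball 0 R, ((2 * k) ^ q / L ((2 * k) ^ β) * L (v x ^ β)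
        + 8 * (v x ^ q * hh k (v x) ^ 3)) := by
        apply integral_mono_of_nonneg
        · exact Eventually.of_forall fun x => by positivity
        · exact (hIntg.const_mul _).add (hvqi'.const_mul _)
        · filter_upwards [ae_restrict_mem measurableSet_ball] with x hx
          have hvx := hv.pos x hx
          have hLv := hLpos _ (Real.rpow_pos_of_pos hvx β)
          have hh0 := hh_nonneg k (v x)
          rw [abs_of_pos hvx]
          rcases le_total (v x) (2 * k) with h | h
          · have := hslow (v x ^ β) (Real.rpow_pos_of_pos hvx _) (Real.rpow_le_rpow hvx.le h hβ.le)
            rw [← Real.rpow_mul hvx.le, ← Real.rpow_mul (by positivity), mul_div_cancel₀ _ hβ.ne'] at this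
            have h2 : v x ^ q ≤ (2 * k) ^ q / L ((2 * k) ^ β) * L (v x ^ β) := by
              rw [div_mul_eq_mul_div, le_div_iff₀ hL2]; linarith
            have : 0 ≤ 8 * (v x ^ q * hh k (v x) ^ 3) := by positivity
            linarith
          · have h1 : 1/2 ≤ hh k (v x) := by
              refine le_trans ?_ (hh_ge k (v x))
              have : k / v x ≤ 1/2 := by rw [div_le_div_iff₀ hvx (by norm_num)]; linarith
              linarith
            have h2 := pow_le_pow_left₀ (by norm_num) h1 3
            have h3 : 0 < v x ^ q := by positivity
            have h4 : 0 ≤ (2 * k) ^ q / L ((2 * k) ^ β) * L (v x ^ β) := by positivity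
            nlinarith
    _ = (2 * k) ^ q / L ((2 * k) ^ β) * (∫ x in ball 0 R, L (v x ^ β))
        + 8 * ∫ x in ball 0 R, v x ^ q * hh k (v x) ^ 3 := by
        rw [integral_add (hIntg.const_mul _) (hvqi'.const_mul _), integral_const_mul, integral_const_mul]
    _ ≤ _ := by gcongr

lemma L_zero {n : ℕ} (hn : 3 ≤ n) {L : ℝ → ℝ} (hLcont : ContinuousOn L (Ici 0))
    (hLpos : ∀ s ∈ Ioi (0:ℝ), 0 < L s) (hLmono : MonotoneOn L (Ioi 0))
    {u₀ : EuclideanSpace ℝ (Fin n) → ℝ} (hu₀pos : ∀ x, 0 < u₀ x)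
    (hu₀int : Integrable (fun x => L (u₀ x)) volume) : L 0 = 0 := by
  have hlim : Tendsto L (nhdsWithin 0 (Ioi 0)) (nhds (L 0)) :=
    (hLcont 0 (by simp)).mono_left (nhdsWithin_mono _ Ioi_subset_Ici_self)
  have h0 : 0 ≤ L 0 := by
    apply ge_of_tendsto hlim
    filter_upwards [self_mem_nhdsWithin] with s hs using (hLpos s hs).le
  have hle : ∀ s, 0 < s → L 0 ≤ L s := fun s hs => by
    apply le_of_tendsto hlim
    filter_upwards [Ioc_mem_nhdsGT hs] with r hr using hLmono hr.1 hs hr.2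
  by_contra hne
  have hpos : 0 < L 0 := lt_of_le_of_ne h0 (Ne.symm hne)
  have h1 : Integrable (fun _ : EuclideanSpace ℝ (Fin n) => L 0) volume := by
    apply hu₀int.mono aestronglyMeasurable_const
    filter_upwards with x
    rw [Real.norm_of_nonneg h0, Real.norm_of_nonneg (hLpos _ (hu₀pos x)).le]
    exact hle _ (hu₀pos x)
  rw [integrable_const_iff] at h1
  rcases h1 with h1 | h1
  · exact hne h1
  · have hnt : Nontrivial (EuclideanSpace ℝ (Fin n)) := by
      have : Nonempty (Fin n) := ⟨⟨0, by omega⟩⟩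
      infer_instance
    have h2 := h1.measure_univ_lt_top
    rw [measure_univ_of_isAddLeftInvariant] at h2
    exact lt_irrefl _ h2

/-- Lemma 3.5 of Fila–Winkler, `L^q` decay bounds for the
approximating solutions on balls.  Let `n ≥ 3`, `p ≥ 1`, and let `L` satisfy (H)
together with the convexity-type condition with constant `q₀ > 0`.  For positive
continuous data `u₀` with `u₀ < min{s₀^{2/p}, s₀^{2/(p+q₀)}}` and `∫ L(u₀) < ∞`,
given approximating data `u0R` and solutions `uRε` of the `ε`-regularized Dirichlet
problems decreasing as `ε ↘ 0` to positive solutions `uR` of the Dirichlet problem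
with zero boundary data, there is `q₁ ∈ (0,q₀)` such that for every `q ∈ (0,q₁)`
there are `t₀ > 0` and `C > 0`, independent of `R`, with
`‖uR(·,t)‖_{L^q(B_R)} ≤ C t^{-1/p} L(1/t)^{-(np+2q)/(npq)}` for all `t ≥ t₀`,
where `‖φ‖_{L^q(B_R)} = (∫_{B_R} |φ|^q)^{1/q}`. -/
theorem stmt_7 (n : ℕ) (hn : 3 ≤ n)
    (p q₀ s₀ : ℝ) (hp : 1 ≤ p) (hq₀ : 0 < q₀) (hs₀ : 0 < s₀)
    (L L' L'' : ℝ → ℝ)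
    (hLcont : ContinuousOn L (Set.Ici 0))
    (hLderiv : ∀ s ∈ Set.Ioo 0 s₀, HasDerivAt L (L' s) s)
    (hL'deriv : ∀ s ∈ Set.Ioo 0 s₀, HasDerivAt L' (L'' s) s)
    (hL''cont : ContinuousOn L'' (Set.Ioo 0 s₀))
    (hLpos : ∀ s ∈ Set.Ioi (0:ℝ), 0 < L s)
    (hLmono : MonotoneOn L (Set.Ioi 0))
    (hH : ∃ a > 0, ∃ lam₀ > 0, ∀ s ∈ Set.Ioo 0 s₀, ∀ l ∈ Set.Ioo 0 lam₀,
      L s ≤ (1 + a * l) * L (s ^ (1 + l)))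
    (hLconv : ∀ s ∈ Set.Ioo 0 s₀, s * L'' s ≥ -((3*p + q₀ - 2)/(p + q₀)) * L' s)
    (u₀ : EuclideanSpace ℝ (Fin n) → ℝ)
    (hu₀cont : Continuous u₀) (hu₀pos : ∀ x, 0 < u₀ x)
    (hu₀small : ∀ x, u₀ x < min (s₀ ^ ((2:ℝ)/p)) (s₀ ^ ((2:ℝ)/(p + q₀))))
    (hu₀int : Integrable (fun x => L (u₀ x)) volume)
    (u0R : ℝ → EuclideanSpace ℝ (Fin n) → ℝ)
    (hu0R_smooth : ∀ R > (0:ℝ), ContDiffOn ℝ 3 (u0R R)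
      (Metric.closedBall (0 : EuclideanSpace ℝ (Fin n)) R))
    (hu0R_pos : ∀ R > (0:ℝ), ∀ x ∈ Metric.ball (0 : EuclideanSpace ℝ (Fin n)) R,
      0 < u0R R x ∧ u0R R x < u₀ x)
    (hu0R_bdry : ∀ R > (0:ℝ), ∀ x ∈ Metric.sphere (0 : EuclideanSpace ℝ (Fin n)) R,
      u0R R x = 0)
    (uRε : ℝ → ℝ → EuclideanSpace ℝ (Fin n) → ℝ → ℝ)
    (uR : ℝ → EuclideanSpace ℝ (Fin n) → ℝ → ℝ)
    (huRε_sol : ∀ R > (0:ℝ), ∀ ε ∈ Set.Ioo (0:ℝ) 1,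
      IsBallSol n p R ε (Metric.closedBall (0 : EuclideanSpace ℝ (Fin n)) R)
        (fun x => u0R R x + ε) (uRε R ε))
    (huRε_lower : ∀ R > (0:ℝ), ∀ ε ∈ Set.Ioo (0:ℝ) 1,
      ∀ x ∈ Metric.ball (0 : EuclideanSpace ℝ (Fin n)) R, ∀ t > (0:ℝ),
        ε ≤ uRε R ε x t)
    (huRε_mono : ∀ R > (0:ℝ), ∀ ε₁ ∈ Set.Ioo (0:ℝ) 1, ∀ ε₂ ∈ Set.Ioo (0:ℝ) 1, ε₁ ≤ ε₂ →
      ∀ x ∈ Metric.closedBall (0 : EuclideanSpace ℝ (Fin n)) R, ∀ t ≥ (0:ℝ),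
        uRε R ε₁ x t ≤ uRε R ε₂ x t)
    (huRε_lim : ∀ R > (0:ℝ), ∀ x ∈ Metric.closedBall (0 : EuclideanSpace ℝ (Fin n)) R,
      ∀ t ≥ (0:ℝ), Filter.Tendsto (fun ε => uRε R ε x t)
        (nhdsWithin 0 (Set.Ioi 0)) (nhds (uR R x t)))
    (huR_sol : ∀ R > (0:ℝ),
      IsBallSol n p R 0 (Metric.ball (0 : EuclideanSpace ℝ (Fin n)) R)
        (u0R R) (uR R))
    (huR_pos : ∀ R > (0:ℝ), ∀ x ∈ Metric.ball (0 : EuclideanSpace ℝ (Fin n)) R,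
      ∀ t ≥ (0:ℝ), 0 < uR R x t) :
    ∃ q₁ ∈ Set.Ioo 0 q₀, ∀ q ∈ Set.Ioo (0:ℝ) q₁, ∃ t₀ > (0:ℝ), ∃ C > (0:ℝ),
      ∀ R > (0:ℝ), ∀ t ≥ t₀,
        (∫ x in Metric.ball (0 : EuclideanSpace ℝ (Fin n)) R, |uR R x t| ^ q) ^ (1/q) ≤
          C * t ^ (-(1:ℝ)/p) * L (1/t) ^ (-(((n:ℝ)*p + 2*q) / ((n:ℝ)*p*q))) := by
  have hp0 : 0 < p := by linarith
  have hn' : (3:ℝ) ≤ n := by exact_mod_cast hn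
  have hL0 : L 0 = 0 := L_zero hn hLcont hLpos hLmono hu₀pos hu₀int
  set β := (p + q₀) / 2 with hβ
  have hβ0 : 0 < β := by positivity
  set Mb := s₀ ^ ((2:ℝ)/(p + q₀)) with hMb
  have hMb0 : 0 < Mb := by positivity
  have hMbβ : Mb ^ β = s₀ := by
    rw [hMb, ← Real.rpow_mul hs₀.le]
    have : 2 / (p + q₀) * β = 1 := by rw [hβ]; field_simp
    rw [this, Real.rpow_one]
  -- good solutions
  have hgood : ∀ R > (0:ℝ), ∃ M1 < Mb, GoodSol n p R M1 (u0R R) (uR R) := by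
    intro R hR
    have hcb : (closedBall (0 : EuclideanSpace ℝ (Fin n)) R).Nonempty := ⟨0, by simp [hR.le]⟩
    obtain ⟨y, hy, hymax⟩ := (isCompact_closedBall (0 : EuclideanSpace ℝ (Fin n)) R).exists_isMaxOn hcb
      (hu0R_smooth R hR).continuousOn
    have h0b : (0 : EuclideanSpace ℝ (Fin n)) ∈ ball 0 R := by simp [hR]
    have hpos : 0 ≤ u0R R y := ((hu0R_pos R hR 0 h0b).1.le).trans (hymax (ball_subset_closedBall h0b))
    have hlt : u0R R y < Mb := by
      rcases (mem_closedBall.1 hy).eq_or_lt with h1 | h1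
      · rw [hu0R_bdry R hR y (mem_sphere.2 h1)]; exact hMb0
      · exact ((hu0R_pos R hR y h1).2).trans ((hu₀small y).trans_le (min_le_right _ _))
    refine ⟨u0R R y, hlt, huR_sol R hR, huR_pos R hR, ?_, ?_⟩
    · intro x hx t ht
      exact sup_bound subset_rfl (huR_sol R hR) hpos (fun z hz => hymax hz)
        (fun z hz s hs => huR_pos R hR z hz s hs.le) x (ball_subset_closedBall hx) t ht
    · intro x hx t t' ht htt
      have hxc := ball_subset_closedBall hx
      have l1 := (huRε_lim R hR x hxc t ht.le).const_mul (t ^ (1/p))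
      have l2 := (huRε_lim R hR x hxc t' (ht.trans htt).le).const_mul (t' ^ (1/p))
      refine le_of_tendsto_of_tendsto l1 l2 ?_
      filter_upwards [Ioo_mem_nhdsGT (zero_lt_one' ℝ)] with ε hε
      refine ab_mono_eps hp ball_subset_closedBall (huRε_sol R hR ε hε) hε.1 ?_ ?_ hx ht htt
      · intro z hz
        have : 0 ≤ u0R R z := by
          rcases (mem_closedBall.1 hz).eq_or_lt with h1 | h1
          · rw [hu0R_bdry R hR z (mem_sphere.2 h1)]
          · exact (hu0R_pos R hR z h1).1.le
        have := hε.1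
        linarith
      · intro z hz s hs
        exact hε.1.trans_le (huRε_lower R hR ε hε z hz s hs)
  -- mass bound
  obtain ⟨C3, hC3, hLC3⟩ := L_pow_le hs₀ hLmono hLpos hH hβ0
  set K := C3 * ∫ x, L (u₀ x) with hK
  have hK0 : 0 ≤ K := mul_nonneg hC3.le (integral_nonneg fun x => (hLpos _ (hu₀pos x)).le)
  have hmass : ∀ R > (0:ℝ), ∀ t > (0:ℝ), ∫ x in ball 0 R, L (uR R x t ^ β) ≤ K := by
    intro R hR t ht
    obtain ⟨M1, hM1, hg⟩ := hgood R hR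
    refine (hg.mass hp hq₀ hs₀ hLcont hL0 hLderiv hL'deriv hL''cont hLpos hLmono hLconv hM1 ht).trans ?_
    have e1 : ∫ x in ball 0 R, L (uR R x 0 ^ β) ≤ ∫ x in ball 0 R, C3 * L (u₀ x) := by
      apply setIntegral_mono_on (hg.L_int hβ0 hLcont hLpos hLmono le_rfl)
        (hu₀int.const_mul C3).integrableOn measurableSet_ball
      intro x hx
      have a1 := hu0R_pos R hR x hx
      rw [(huR_sol R hR).2.1 x (ball_subset_closedBall hx)]
      have a2 : u0R R x ^ β ≤ u₀ x ^ β := Real.rpow_le_rpow a1.1.le a1.2.le hβ0.le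
      have a3 : u₀ x ^ β < s₀ := by
        rw [← hMbβ]
        exact Real.rpow_lt_rpow (hu₀pos x).le ((hu₀small x).trans_le (min_le_right _ _)) hβ0
      exact (hLmono (Real.rpow_pos_of_pos a1.1 _) (Real.rpow_pos_of_pos (hu₀pos x) _) a2).trans
        (hLC3 _ (hu₀pos x) a3)
    refine e1.trans ?_
    rw [integral_const_mul, hK]
    apply mul_le_mul_of_nonneg_left _ hC3.le
    apply setIntegral_le_integral hu₀int
    exact Eventually.of_forall fun x => (hLpos _ (hu₀pos x)).le
  refine ⟨min q₀ 1 / 2, ⟨by positivity, ?_⟩, ?_⟩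
  · have := min_le_left q₀ 1
    linarith
  rintro q ⟨hq, hqlt⟩
  have hq1 : q < 1 := by have := min_le_right q₀ 1; linarith
  obtain ⟨C1, hC1, hkey⟩ := key_spatial hn hp hq hq1
  obtain ⟨C2, hC2, hLC2⟩ := H_iter hLmono hLpos hH (1 + q₀ / p)
  obtain ⟨d1, hd10, hd11, hd1s, hsl1⟩ := H_slow hs₀ hLpos hH (show 0 < q / β by positivity)
  obtain ⟨d2, hd20, hd21, hd2s, hsl2⟩ := H_slow hs₀ hLpos hH (show 0 < q / (2 * β) by positivity)
  -- large times
  have hev : ∀ᶠ t : ℝ in atTop, 1 < t ∧ 1 / t < s₀ ∧ (2 * t ^ (-(2 / p))) ^ β ≤ min d1 d2 := by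
    have e1 : Tendsto (fun t : ℝ => (2 * t ^ (-(2 / p))) ^ β) atTop (nhds 0) := by
      have := (tendsto_rpow_neg_atTop (show 0 < 2 / p by positivity)).const_mul 2
      have h2 := this.rpow_const (p := β) (Or.inr hβ0.le)
      simpa [hβ0.ne'] using h2
    have e2 : Tendsto (fun t : ℝ => 1 / t) atTop (nhds 0) := by
      simpa using tendsto_inv_atTop_zero (𝕜 := ℝ)
    filter_upwards [eventually_gt_atTop 1, e2.eventually_lt_const hs₀,
      e1.eventually_lt_const (lt_min hd10 hd20)] with t h1 h2 h3
    exact ⟨h1, h2, h3.le⟩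
  obtain ⟨t₀, ht₀⟩ := eventually_atTop.1 hev
  set e := 1 + 2 * q / (n * p) with he
  have he0 : 0 < e := by positivity
  set c2 := L d2 / d2 ^ (q / (2 * β)) with hc2
  have hc20 : 0 < c2 := div_pos (hLpos _ hd20) (by positivity)
  have hL1 : 0 < L 1 := hLpos 1 (by simp)
  set C := c2⁻¹ * 2 ^ (q / 2) * K * L 1 ^ e + 8 * C1 * (K * C2) ^ e + 1 with hC
  have hC0 : 0 < C := by positivity
  refine ⟨max t₀ 1, by positivity, C ^ (1 / q), by positivity, ?_⟩
  intro R hR t ht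
  obtain ⟨ht1, hts, htd⟩ := ht₀ t ((le_max_left _ _).trans ht)
  have ht0 : 0 < t := by linarith
  obtain ⟨M1, hM1, hg⟩ := hgood R hR
  have hv : Slice R Mb (fun x => uR R x t) := hg.slice hM1 ht0
  set k := t ^ (-(2 / p)) with hk
  have hk0 : 0 < k := by positivity
  have hIntg := hg.L_int hβ0 hLcont hLpos hLmono ht0.le
  have hKm := hmass R hR t ht0
  have hLt : 0 < L (1 / t) := hLpos _ (by simpa using ht0)
  have h2k : 0 < (2 * k) ^ β := by positivity
  -- measure of superlevel set
  have hS : volume.real {x ∈ ball 0 R | k < uR R x t} ≤ K * C2 / L (1 / t) := by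
    refine (S_bound hv hβ0 hk0 hLmono hLpos hIntg hKm).trans ?_
    have e1 : k ^ β = (1 / t) ^ (1 + q₀ / p) := by
      rw [hk, ← Real.rpow_mul ht0.le, one_div, Real.inv_rpow ht0.le, ← Real.rpow_neg ht0.le]
      congr 1; rw [hβ]; field_simp
    have e2 := hLC2 (1 / t) (by positivity) (by rw [div_lt_one ht0]; exact ht1) hts
    rw [← e1] at e2
    have e3 : 0 < L (k ^ β) := hLpos _ (Real.rpow_pos_of_pos hk0 _)
    rw [div_le_div_iff₀ e3 hLt]
    calc K * L (1 / t) ≤ K * (C2 * L (k ^ β)) := by gcongr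
      _ = _ := by ring
  have hZ := hkey R Mb _ hv k hk0 t ht0 (fun x hx => hg.lap_ge hp0 hx ht0)
  have hsplit := split_bound hv hβ0 hk0 hq hLpos hIntg hKm
    (fun s hs hsd => hsl1 s _ hs hsd (htd.trans (min_le_left _ _)))
  set W := t ^ (-q / p) * L (1 / t) ^ (-e) with hW
  have hW0 : 0 < W := by positivity
  have hA : (2 * k) ^ q / L ((2 * k) ^ β) * K ≤ c2⁻¹ * 2 ^ (q / 2) * K * L 1 ^ e * W := by
    have f1 := hsl2 _ d2 h2k (htd.trans (min_le_right _ _)) le_rfl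
    have f2 : ((2 * k) ^ β) ^ (q / (2 * β)) = (2 * k) ^ (q / 2) := by
      rw [← Real.rpow_mul (by positivity)]; congr 1; field_simp
    rw [f2] at f1
    have f3 : c2 * (2 * k) ^ (q / 2) ≤ L ((2 * k) ^ β) := by
      rw [hc2, div_mul_eq_mul_div, div_le_iff₀ (by positivity)]; exact f1
    have f4 : (2 * k) ^ q / L ((2 * k) ^ β) ≤ c2⁻¹ * (2 * k) ^ (q / 2) := by
      rw [div_le_iff₀ (hLpos _ h2k)]
      calc (2 * k) ^ q = c2⁻¹ * (2 * k) ^ (q / 2) * (c2 * (2 * k) ^ (q / 2)) := by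
            rw [show q = q / 2 + q / 2 by ring, Real.rpow_add (by positivity)]
            field_simp
            ring_nf
        _ ≤ _ := by gcongr
    have f5 : (2 * k) ^ (q / 2) = 2 ^ (q / 2) * t ^ (-q / p) := by
      rw [Real.mul_rpow (by norm_num) hk0.le, hk, ← Real.rpow_mul ht0.le]
      congr 2; field_simp
    have f6 : 1 ≤ L 1 ^ e * L (1 / t) ^ (-e) := by
      rw [Real.rpow_neg hLt.le, ← div_eq_mul_inv, one_le_div (by positivity)]
      apply Real.rpow_le_rpow hLt.le _ he0.le
      exact hLmono (by simpa using ht0) (by simp) (by rw [div_le_one ht0]; exact ht1.le)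
    calc (2 * k) ^ q / L ((2 * k) ^ β) * K ≤ c2⁻¹ * (2 * k) ^ (q / 2) * K := by gcongr
      _ = c2⁻¹ * (2 ^ (q / 2) * t ^ (-q / p)) * K * 1 := by rw [f5, mul_one]
      _ ≤ c2⁻¹ * (2 ^ (q / 2) * t ^ (-q / p)) * K * (L 1 ^ e * L (1 / t) ^ (-e)) := by gcongr
      _ = _ := by rw [hW]; ring
  have hB : ∫ x in ball 0 R, uR R x t ^ q * hh k (uR R x t) ^ 3 ≤ C1 * (K * C2) ^ e * W := by
    refine hZ.trans ?_
    calc _ ≤ C1 * t ^ (-q / p) * (K * C2 / L (1 / t)) ^ e := by gcongr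
      _ = _ := by
        rw [Real.div_rpow (by positivity) hLt.le, hW, Real.rpow_neg hLt.le]; ring
  have hI : ∫ x in ball 0 R, |uR R x t| ^ q ≤ C * W := by
    calc _ ≤ _ := hsplit
      _ ≤ c2⁻¹ * 2 ^ (q / 2) * K * L 1 ^ e * W + 8 * (C1 * (K * C2) ^ e * W) := by gcongr
      _ ≤ C * W := by rw [hC]; nlinarith
  calc _ ≤ (C * W) ^ (1 / q) := by
        apply Real.rpow_le_rpow _ hI (by positivity)
        exact integral_nonneg fun x => by positivity
    _ = _ := by
        rw [Real.mul_rpow hC0.le hW0.le, hW, Real.mul_rpow (by positivity) (by positivity),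
          ← Real.rpow_mul ht0.le, ← Real.rpow_mul hLt.le, ← mul_assoc]
        have g1 : -q / p * (1 / q) = -1 / p := by field_simp
        have g2 : -e * (1 / q) = -(((n:ℝ) * p + 2 * q) / (n * p * q)) := by
          rw [he]; field_simp
        rw [g1, g2]
end

section
/- Let n ≥ 1, p ≥ 1, q > 0, R > 0 and t > 0. Let v ∈ C⁰(B̄_R) ∩ C²(B_R) be positive in B_R, radially symmetric and nonincreasing with respect to |x|, with v = 0 on ∂B_R, and suppose v(x)^{p−1}·Δv(x) ≥ −1/(pt) for all x ∈ B_R. Then ‖v‖_{L^∞(B_R)} ≤ ( 2^{q+n(p−1)/2} · n / (p^{n/2} · ω_n) )^{2/(np+2q)} · t^{−n/(np+2q)} · ‖v‖_{L^q(B_R)}^{2q/(np+2q)}, where ω_n := n·|B₁| with |B₁| the Lebesgue measure of the unit ball in ℝⁿ. -/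
open Real Set MeasureTheory Metric

/-- Second derivative test at an interior local maximum. -/
lemma second_deriv_le_zero (g g' : ℝ → ℝ) (c : ℝ)
    (hg : ∀ᶠ s in nhds (0:ℝ), HasDerivAt g (g' s) s) (hg' : HasDerivAt g' c 0)
    (hmax : IsLocalMax g 0) : c ≤ 0 := by
  by_contra! hc
  have hev : deriv g =ᶠ[nhds 0] g' := hg.mono fun s hs => hs.deriv
  have hd2 : deriv (deriv g) 0 = c := by rw [hev.deriv_eq, hg'.deriv]
  have hmin : IsLocalMin g 0 :=
    isLocalMin_of_deriv_deriv_pos (by rw [hd2]; exact hc) hmax.deriv_eq_zero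
      hg.self_of_nhds.continuousAt
  have hconst : g =ᶠ[nhds 0] fun _ => g 0 := by
    filter_upwards [hmin, hmax] with s h1 h2
    exact le_antisymm h2 h1
  have h1 : deriv g =ᶠ[nhds 0] deriv (fun _ => g 0) := hconst.deriv
  have h2 : deriv (deriv g) 0 = 0 := by
    rw [h1.deriv_eq]; simp
  linarith

/-- At an interior local max of `v + a |x|^2` the Laplacian of `v` is at most `-2na`. -/
lemma lap_le_of_localMax {n : ℕ} (v : EuclideanSpace ℝ (Fin n) → ℝ) (a : ℝ)
    (x : EuclideanSpace ℝ (Fin n)) (hv : ContDiffAt ℝ 2 v x)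
    (hmax : IsLocalMax (fun y => v y + a * ‖y‖ ^ 2) x) :
    lap v x + 2 * n * a ≤ 0 := by
  have key : ∀ i : Fin n, fderiv ℝ (fun y => fderiv ℝ v y (EuclideanSpace.single i 1)) x
    (EuclideanSpace.single i 1) ≤ - (2 * a) := by
    intro i
    set e : EuclideanSpace ℝ (Fin n) := EuclideanSpace.single i 1 with he
    have hne : ‖e‖ = 1 := by simp [he]
    have hline : ∀ s : ℝ, HasDerivAt (fun s : ℝ => x + s • e) e s := by
      intro s
      simpa using ((hasDerivAt_id s).smul_const e).const_add x
    have hcont : Filter.Tendsto (fun s : ℝ => x + s • e) (nhds 0) (nhds x) := by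
      have := (hline 0).continuousAt.tendsto
      simpa using this
    have hdv : ∀ᶠ y in nhds x, DifferentiableAt ℝ v y := by
      have := hv.eventually (by simp)
      exact this.mono fun y hy => hy.differentiableAt (by simp)
    have hd2 : DifferentiableAt ℝ (fun y => fderiv ℝ v y e) x := by
      have h1 : ContDiffAt ℝ 1 (fderiv ℝ v) x := hv.fderiv_right (by norm_num)
      exact (h1.differentiableAt (by simp)).clm_apply (differentiableAt_const e)
    have hx0 : x + (0:ℝ) • e = x := by simp
    have := second_deriv_le_zero
      (fun s => v (x + s • e) + a * ‖x + s • e‖ ^ 2)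
      (fun s => fderiv ℝ v (x + s • e) e + a * (2 * inner ℝ x e + 2 * s))
      (fderiv ℝ (fun y => fderiv ℝ v y e) x e + a * 2) ?_ ?_ ?_
    · linarith
    · filter_upwards [hcont.eventually hdv] with s hs
      have h1 : HasDerivAt (fun s : ℝ => v (x + s • e)) (fderiv ℝ v (x + s • e) e) s :=
        hs.hasFDerivAt.comp_hasDerivAt s (hline s)
      have h2 : (fun s : ℝ => ‖x + s • e‖ ^ 2) =
          fun s => ‖x‖ ^ 2 + 2 * (s * inner ℝ x e) + s ^ 2 := by
        funext s
        rw [norm_add_sq_real, inner_smul_right, norm_smul, hne]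
        simp
      have h3 : HasDerivAt (fun s : ℝ => ‖x + s • e‖ ^ 2) (2 * inner ℝ x e + 2 * s) s := by
        rw [h2]
        have := ((((hasDerivAt_id s).mul_const (inner ℝ x e)).const_mul 2).const_add
          (‖x‖ ^ 2)).add ((hasDerivAt_id s).pow 2)
        have heq : 2 * (1 * inner ℝ x e) + ((2:ℕ):ℝ) * id s ^ (2 - 1) * 1
            = 2 * inner ℝ x e + 2 * s := by simp
        rw [heq] at this
        exact this
      exact h1.add (h3.const_mul a)
    · have h1 : HasDerivAt (fun s : ℝ => fderiv ℝ v (x + s • e) e)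
          (fderiv ℝ (fun y => fderiv ℝ v y e) x e) 0 := by
        have h := hd2.hasFDerivAt
        rw [← hx0] at h
        have := h.comp_hasDerivAt 0 (hline 0)
        rw [hx0] at this
        exact this
      have h2 : HasDerivAt (fun s : ℝ => a * (2 * inner ℝ x e + 2 * s)) (a * 2) 0 := by
        have := (((hasDerivAt_id (0:ℝ)).const_mul 2).const_add (2 * inner ℝ x e)).const_mul a
        simpa using this
      exact h1.add h2
    · have : Filter.Tendsto (fun s : ℝ => x + s • e) (nhds 0) (nhds x) := hcont
      have h := this.eventually hmax
      filter_upwards [h] with s hs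
      simpa using hs
  have : lap v x ≤ ∑ i : Fin n, -(2 * a) := Finset.sum_le_sum fun i _ => key i
  simp at this
  linarith

lemma final_alg (n : ℕ) (hn : 1 ≤ n) (p q t M V I r : ℝ) (hp : 1 ≤ p) (hq : 0 < q)
    (ht : 0 < t) (hM : 0 < M) (hV : 0 < V) (hr : 0 < r)
    (hr2 : M * (p * t) * (M / 2) ^ (p - 1) ≤ r ^ 2)
    (hI : (M / 2) ^ q * (r ^ n * V) ≤ I) :
    M ≤ (2 ^ (q + (n:ℝ) * (p - 1) / 2) * (n:ℝ) /
          (p ^ ((n:ℝ) / 2) * ((n:ℝ) * V))) ^ (2 / ((n:ℝ)*p + 2*q)) *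
        t ^ (-(n:ℝ) / ((n:ℝ)*p + 2*q)) * (I ^ (1/q)) ^ (2*q / ((n:ℝ)*p + 2*q)) := by
  have hn' : (0:ℝ) < n := by exact_mod_cast hn
  have hp0 : 0 < p := by linarith
  have hD : 0 < (n:ℝ) * p + 2 * q := by positivity
  have hrn : (M * (p * t) * (M / 2) ^ (p - 1)) ^ ((n:ℝ)/2) ≤ r ^ n := by
    have : r ^ n = (r ^ 2) ^ ((n:ℝ)/2) := by
      rw [← Real.rpow_natCast r 2, ← Real.rpow_mul hr.le, ← Real.rpow_natCast]
      congr 1; push_cast; ring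
    rw [this]
    exact Real.rpow_le_rpow (by positivity) hr2 (by positivity)
  set J := (M / 2) ^ q * ((M * (p * t) * (M / 2) ^ (p - 1)) ^ ((n:ℝ)/2) * V) with hJ
  have hJI : J ≤ I := le_trans (by rw [hJ]; gcongr) hI
  have hJ0 : 0 < J := by positivity
  have hmono : (J ^ (1/q)) ^ (2*q / ((n:ℝ)*p + 2*q)) ≤ (I ^ (1/q)) ^ (2*q / ((n:ℝ)*p + 2*q)) := by
    gcongr
  refine le_trans (le_of_eq ?_) (mul_le_mul_of_nonneg_left hmono (by positivity))
  apply Real.log_injOn_pos (Set.mem_Ioi.2 hM) (Set.mem_Ioi.2 (by positivity))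
  have hlJ : Real.log J = q * (Real.log M - Real.log 2) +
      ((n:ℝ)/2 * (Real.log M + (Real.log p + Real.log t) + (p-1) * (Real.log M - Real.log 2))
        + Real.log V) := by
    rw [hJ, Real.log_mul (by positivity) (by positivity), Real.log_rpow (by positivity),
      Real.log_div (by positivity) (by positivity), Real.log_mul (by positivity) (by positivity),
      Real.log_rpow (by positivity), Real.log_mul (by positivity) (by positivity),
      Real.log_mul (by positivity) (by positivity), Real.log_mul (by positivity) (by positivity),
      Real.log_rpow (by positivity), Real.log_div (by positivity) (by positivity)]
  rw [Real.log_mul (by positivity) (by positivity), Real.log_mul (by positivity) (by positivity),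
    Real.log_rpow (by positivity), Real.log_rpow (by positivity), Real.log_rpow (by positivity),
    Real.log_rpow (by positivity), hlJ, Real.log_div (by positivity) (by positivity),
    Real.log_mul (by positivity) (by positivity), Real.log_mul (by positivity) (by positivity),
    Real.log_mul (by positivity) (by positivity), Real.log_rpow (by positivity),
    Real.log_rpow (by positivity)]
  field_simp
  ring

/-- Lemma 3.6 of Fila–Winkler.
Let `n ≥ 1`, `p ≥ 1`, `q > 0`, `R > 0`, `t > 0`, and let
`v ∈ C⁰(B̄_R) ∩ C²(B_R)` be positive in `B_R`, radially symmetric and nonincreasing in `|x|`,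
vanish on `∂B_R`, and satisfy `v^{p-1}·Δv ≥ -1/(pt)` in `B_R`.  Then
`‖v‖_{L^∞(B_R)} ≤ (2^{q+n(p-1)/2} n/(p^{n/2} ωₙ))^{2/(np+2q)} t^{-n/(np+2q)} ‖v‖_{L^q(B_R)}^{2q/(np+2q)}`,
where `ωₙ = n·|B₁|` and `‖v‖_{L^q(B_R)} = (∫_{B_R} |v|^q)^{1/q}`.  The `L^∞` bound is
expressed pointwise on `B̄_R` (equivalent for a continuous function). -/
theorem stmt_8 (n : ℕ) (hn : 1 ≤ n)
    (p q R t : ℝ) (hp : 1 ≤ p) (hq : 0 < q) (hR : 0 < R) (ht : 0 < t)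
    (v : EuclideanSpace ℝ (Fin n) → ℝ)
    (hv_cont : ContinuousOn v (Metric.closedBall (0 : EuclideanSpace ℝ (Fin n)) R))
    (hv_smooth : ContDiffOn ℝ 2 v (Metric.ball (0 : EuclideanSpace ℝ (Fin n)) R))
    (hv_pos : ∀ x ∈ Metric.ball (0 : EuclideanSpace ℝ (Fin n)) R, 0 < v x)
    (hv_bdry : ∀ x ∈ Metric.sphere (0 : EuclideanSpace ℝ (Fin n)) R, v x = 0)
    (hv_radial : ∃ w : ℝ → ℝ, AntitoneOn w (Set.Icc 0 R) ∧ ∀ x, v x = w ‖x‖)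
    (hv_ineq : ∀ x ∈ Metric.ball (0 : EuclideanSpace ℝ (Fin n)) R,
      v x ^ (p - 1) * lap v x ≥ -(1 / (p * t))) :
    ∀ x ∈ Metric.closedBall (0 : EuclideanSpace ℝ (Fin n)) R,
      v x ≤ (2 ^ (q + (n:ℝ) * (p - 1) / 2) * (n:ℝ) /
          (p ^ ((n:ℝ) / 2) *
            ((n:ℝ) * (MeasureTheory.volume
              (Metric.ball (0 : EuclideanSpace ℝ (Fin n)) 1)).toReal))) ^ (2 / ((n:ℝ)*p + 2*q)) *
        t ^ (-(n:ℝ) / ((n:ℝ)*p + 2*q)) *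
        ((∫ y in Metric.ball (0 : EuclideanSpace ℝ (Fin n)) R, |v y| ^ q) ^ (1/q))
          ^ (2*q / ((n:ℝ)*p + 2*q)) := by
  obtain ⟨w, hw, hvw⟩ := hv_radial
  have hn' : (0:ℝ) < n := by exact_mod_cast hn
  have hp0 : 0 < p := by linarith
  set M := v 0 with hMdef
  have hM : 0 < M := hv_pos 0 (by simpa using hR)
  have hM0 : M = w 0 := by rw [hMdef, hvw]; simp
  -- it suffices to bound the maximum
  intro x hx
  have hx' : ‖x‖ ≤ R := by simpa using hx
  have hxM : v x ≤ M := by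
    rw [hvw, hM0]
    exact hw ⟨le_rfl, hR.le⟩ ⟨norm_nonneg x, hx'⟩ (norm_nonneg x)
  refine hxM.trans ?_
  -- a radius where `v = M / 2`
  let e : EuclideanSpace ℝ (Fin n) := EuclideanSpace.single ⟨0, hn⟩ 1
  have hne : ‖e‖ = 1 := by simp [e]
  have hnorm : ∀ s : ℝ, 0 ≤ s → ‖s • e‖ = s := by
    intro s hs
    rw [norm_smul, hne, Real.norm_of_nonneg hs, mul_one]
  have hwc : ContinuousOn w (Set.Icc 0 R) := by
    have h1 : ContinuousOn (fun s : ℝ => v (s • e)) (Set.Icc 0 R) := by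
      refine hv_cont.comp (by fun_prop) ?_
      intro s hs
      simpa [hnorm s hs.1] using hs.2
    refine h1.congr ?_
    intro s hs
    simp only [hvw, hnorm s hs.1]
  have hwR : w R = 0 := by
    have := hv_bdry (R • e) (by simpa using hnorm R hR.le)
    rwa [hvw, hnorm R hR.le] at this
  obtain ⟨r, hr, hwr⟩ : M / 2 ∈ w '' Set.Icc 0 R := by
    apply intermediate_value_Icc' hR.le hwc
    rw [hwR, ← hM0]
    constructor <;> linarith
  have hr0 : 0 < r := by
    rcases hr.1.lt_or_eq with h | h
    · exact h
    · rw [← h, ← hM0] at hwr; linarith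
  have hrR : r < R := by
    rcases hr.2.lt_or_eq with h | h
    · exact h
    · rw [h, hwR] at hwr; linarith
  have hlow : ∀ y, ‖y‖ ≤ r → M / 2 ≤ v y := by
    intro y hy
    rw [hvw, ← hwr]
    exact hw ⟨norm_nonneg y, hy.trans hr.2⟩ hr hy
  set K := 1 / (p * t) / (M / 2) ^ (p - 1) with hK
  have hpow : 0 < (M / 2) ^ (p - 1) := by positivity
  have hlap : ∀ y, ‖y‖ ≤ r → -K ≤ lap v y := by
    intro y hy
    have h1 := hv_ineq y (by simpa using lt_of_le_of_lt hy hrR)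
    have h2 : (M / 2) ^ (p - 1) ≤ v y ^ (p - 1) :=
      Real.rpow_le_rpow (by positivity) (hlow y hy) (by linarith)
    by_contra! hcon
    have hKp : (M / 2) ^ (p - 1) * K = 1 / (p * t) := by rw [hK]; field_simp
    have hKpos : 0 < K := by positivity
    have h3 : v y ^ (p - 1) * lap v y < v y ^ (p - 1) * (-K) :=
      mul_lt_mul_of_pos_left hcon (lt_of_lt_of_le hpow h2)
    have h4 : (M / 2) ^ (p - 1) * K ≤ v y ^ (p - 1) * K :=
      mul_le_mul_of_nonneg_right h2 hKpos.le
    linarith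
  -- maximum principle
  have hmaxp : ∀ ε > 0, M ≤ M / 2 + (K + ε) / (2 * n) * r ^ 2 := by
    intro ε hε
    set a := (K + ε) / (2 * n) with ha
    have hsub : closedBall (0 : EuclideanSpace ℝ (Fin n)) r ⊆ closedBall 0 R :=
      closedBall_subset_closedBall hr.2
    obtain ⟨z, hz, hzmax⟩ := (isCompact_closedBall (0 : EuclideanSpace ℝ (Fin n)) r).exists_isMaxOn
      ⟨0, by simpa using hr0.le⟩
      (f := fun y => v y + a * ‖y‖ ^ 2)
      ((hv_cont.mono hsub).add (by fun_prop))
    have hz' : ‖z‖ ≤ r := by simpa using hz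
    rcases hz'.lt_or_eq with h | h
    · exfalso
      have hzb : z ∈ ball (0 : EuclideanSpace ℝ (Fin n)) r := by simpa using h
      have hloc : IsLocalMax (fun y => v y + a * ‖y‖ ^ 2) z :=
        hzmax.isLocalMax (Filter.mem_of_superset (isOpen_ball.mem_nhds hzb) ball_subset_closedBall)
      have hcd : ContDiffAt ℝ 2 v z :=
        hv_smooth.contDiffAt (isOpen_ball.mem_nhds (ball_subset_ball hr.2 hzb))
      have h1 := lap_le_of_localMax v a z hcd hloc
      have h2 := hlap z hz'
      have h3 : 2 * n * a = K + ε := by rw [ha]; field_simp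
      linarith
    · have h1 := hzmax (show (0 : EuclideanSpace ℝ (Fin n)) ∈ closedBall 0 r by simpa using hr0.le)
      have h2 : v z = M / 2 := by rw [hvw, h, hwr]
      simp only [Set.mem_ofPred_eq, h, h2, norm_zero] at h1
      simpa using h1
  have hmain : M ≤ M / 2 + K / (2 * n) * r ^ 2 := by
    apply le_of_forall_pos_le_add
    intro δ hδ
    have h := hmaxp (δ * (2 * n) / r ^ 2) (by positivity)
    have : (K + δ * (2 * n) / r ^ 2) / (2 * n) * r ^ 2 = K / (2 * n) * r ^ 2 + δ := by
      field_simp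
    linarith
  have hr2 : M * (p * t) * (M / 2) ^ (p - 1) ≤ r ^ 2 := by
    have h1 : n * M ≤ K * r ^ 2 := by
      have : K / (2 * n) * r ^ 2 = K * r ^ 2 / (2 * n) := by ring
      rw [this] at hmain
      have h2 : M / 2 ≤ K * r ^ 2 / (2 * n) := by linarith
      rw [le_div_iff₀ (by positivity)] at h2
      linarith
    have h2 : M ≤ n * M := by
      have : (1:ℝ) ≤ n := by exact_mod_cast hn
      nlinarith
    have h3 : M ≤ K * r ^ 2 := h2.trans h1
    have h4 : r ^ 2 = (K * r ^ 2) * (p * t) * (M / 2) ^ (p - 1) := by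
      rw [hK]; field_simp
    rw [h4]
    gcongr
  have hVtop : volume (ball (0 : EuclideanSpace ℝ (Fin n)) 1) ≠ ⊤ := measure_ball_lt_top.ne
  have hV : 0 < (volume (ball (0 : EuclideanSpace ℝ (Fin n)) 1)).toReal :=
    ENNReal.toReal_pos (measure_ball_pos _ _ one_pos).ne' hVtop
  refine final_alg n hn p q t M _ _ r hp hq ht hM hV hr0 hr2 ?_
  have hvol : volume.real (ball (0 : EuclideanSpace ℝ (Fin n)) r) =
      r ^ n * (volume (ball (0 : EuclideanSpace ℝ (Fin n)) 1)).toReal := by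
    rw [Measure.real, Measure.addHaar_ball_of_pos _ _ hr0, ENNReal.toReal_mul,
      ENNReal.toReal_ofReal (by positivity)]
    simp
  have hint : IntegrableOn (fun y => |v y| ^ q) (ball (0 : EuclideanSpace ℝ (Fin n)) R) := by
    refine IntegrableOn.mono_set ?_ ball_subset_closedBall
    refine ContinuousOn.integrableOn_compact (isCompact_closedBall _ _) ?_
    exact hv_cont.abs.rpow_const fun y _ => Or.inr hq.le
  calc (M / 2) ^ q * (r ^ n * (volume (ball (0 : EuclideanSpace ℝ (Fin n)) 1)).toReal)
      = ∫ y in ball (0 : EuclideanSpace ℝ (Fin n)) r, (M / 2) ^ q := by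
        rw [setIntegral_const, hvol, smul_eq_mul, mul_comm]
    _ ≤ ∫ y in ball (0 : EuclideanSpace ℝ (Fin n)) r, |v y| ^ q := by
        refine setIntegral_mono_on (integrableOn_const measure_ball_lt_top.ne)
          (hint.mono_set (ball_subset_ball hr.2)) measurableSet_ball ?_
        intro y hy
        have hy' : ‖y‖ ≤ r := by simpa using (mem_ball_zero_iff.1 hy).le
        exact Real.rpow_le_rpow (by positivity) ((hlow y hy').trans (le_abs_self _)) hq.le
    _ ≤ ∫ y in ball (0 : EuclideanSpace ℝ (Fin n)) R, |v y| ^ q := by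
        refine setIntegral_mono_set hint ?_ (ball_subset_ball hr.2).eventuallyLE
        exact Filter.Eventually.of_forall fun y => Real.rpow_nonneg (abs_nonneg _) _
end

section
/- Let p ≥ 1 and let Λ ∈ C⁰([0,∞)) be strictly increasing with Λ(s)/ln s → +∞ as s → ∞. Let u be a positive classical solution of the Cauchy problem (0) on ℝⁿ×(0,∞) with initial data u₀ ∈ C⁰(ℝⁿ) satisfying u₀(x) ≥ e^{−Λ(|x|)} for all x ∈ ℝⁿ. Then there exist t₀ > 0 and C > 0 such that C·ln t lies in the range of Λ for every t ≥ t₀ and ‖u(·,t)‖_{L^∞(ℝⁿ)} ≥ C · t^{−1/p} · ( Λ^{−1}(C·ln t) )^{2/p} for all t ≥ t₀, where Λ^{−1} denotes the inverse of Λ. -/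
open Real Set MeasureTheory Metric Filter

/-- `u` is a positive classical solution of the Cauchy problem `u_t = u^p Δu`,
`u(·,0) = u₀`, on `ℝⁿ × (0,T)`: it is continuous on `ℝⁿ × [0,T)`, attains the initial
data, is positive and spatially `C²` for `0 < t < T`, and satisfies the PDE pointwise. -/
def IsSolOn (n : ℕ) (p : ℝ) (u₀ : EuclideanSpace ℝ (Fin n) → ℝ)
    (u : EuclideanSpace ℝ (Fin n) → ℝ → ℝ) (T : ℝ) : Prop :=
  ContinuousOn (fun z : (EuclideanSpace ℝ (Fin n)) × ℝ => u z.1 z.2) {z | 0 ≤ z.2 ∧ z.2 < T} ∧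
  (∀ x, u x 0 = u₀ x) ∧
  (∀ x, ∀ t, 0 < t → t < T → 0 < u x t) ∧
  (∀ t, 0 < t → t < T → ContDiff ℝ 2 (fun y => u y t)) ∧
  (∀ x, ∀ t, 0 < t → t < T →
    HasDerivAt (fun s => u x s) (u x t ^ p * lap (fun y => u y t) x) t)

/-- `u` is a global positive classical solution of the Cauchy problem
`u_t = u^p Δu` on `ℝⁿ × (0,∞)`, `u(·,0) = u₀`. -/
def IsSol (n : ℕ) (p : ℝ) (u₀ : EuclideanSpace ℝ (Fin n) → ℝ)
    (u : EuclideanSpace ℝ (Fin n) → ℝ → ℝ) : Prop :=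
  ContinuousOn (fun z : (EuclideanSpace ℝ (Fin n)) × ℝ => u z.1 z.2) {z | 0 ≤ z.2} ∧
  (∀ x, u x 0 = u₀ x) ∧
  (∀ x, ∀ t, 0 < t → 0 < u x t) ∧
  (∀ t, 0 < t → ContDiff ℝ 2 (fun y => u y t)) ∧
  (∀ x, ∀ t, 0 < t →
    HasDerivAt (fun s => u x s) (u x t ^ p * lap (fun y => u y t) x) t)

/-- `u` is the minimal global positive classical solution of the Cauchy problem:
whenever `T ∈ (0,∞]` and `v` is a positive classical solution on `ℝⁿ × (0,T)`, then
`u ≤ v` there.  (Quantifying over all finite `T > 0` covers `T = ∞`, since the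
restriction of a global solution solves the problem on every `(0,T)`.) -/
def IsMinimalSol (n : ℕ) (p : ℝ) (u₀ : EuclideanSpace ℝ (Fin n) → ℝ)
    (u : EuclideanSpace ℝ (Fin n) → ℝ → ℝ) : Prop :=
  IsSol n p u₀ u ∧
  ∀ T > (0:ℝ), ∀ v, IsSolOn n p u₀ v T → ∀ x, ∀ t, 0 ≤ t → t < T → u x t ≤ v x t


theorem aux_second {g g' : ℝ → ℝ} {d : ℝ} (hg : ∀ s, HasDerivAt g (g' s) s)
    (hd : HasDerivAt g' d 0) (hmin : IsLocalMin g 0) : 0 ≤ d := by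
  have hgd : deriv g = g' := funext fun s => (hg s).deriv
  by_contra hneg
  push Not at hneg
  have hmax : IsLocalMax g 0 := by
    apply isLocalMax_of_deriv_deriv_neg
    · rw [hgd, hd.deriv]; exact hneg
    · exact hmin.deriv_eq_zero
    · exact (hg 0).continuousAt
  have hconst : g =ᶠ[nhds 0] fun _ => g 0 := by
    filter_upwards [hmin, hmax] with s h1 h2
    exact le_antisymm h2 h1
  have h1 : deriv g =ᶠ[nhds 0] deriv (fun _ => g 0) := hconst.deriv
  have h2 := h1.deriv_eq
  rw [hgd, hd.deriv] at h2
  simp at h2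
  linarith

theorem aux_time {k : ℝ → ℝ} {d t : ℝ} (ht : 0 < t) (hk : HasDerivAt k d t)
    (hmin : ∀ s, 0 ≤ s → s ≤ t → k t ≤ k s) : d ≤ 0 := by
  have h1 : HasDerivWithinAt k d (Set.Iio t) t := hk.hasDerivWithinAt
  rw [hasDerivWithinAt_iff_tendsto_slope' (by simp)] at h1
  refine le_of_tendsto h1 ?_
  have h2 : Set.Ioo 0 t ∈ nhdsWithin t (Set.Iio t) := Ioo_mem_nhdsLT ht
  filter_upwards [h2] with s hs
  rw [slope_def_field]
  apply div_nonpos_of_nonneg_of_nonpos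
  · linarith [hmin s hs.1.le hs.2.le]
  · linarith [hs.2]

theorem aux_lap {n : ℕ} {f : EuclideanSpace ℝ (Fin n) → ℝ} (hf : ContDiff ℝ 2 f)
    (x : EuclideanSpace ℝ (Fin n)) (a : ℝ)
    (hmin : IsLocalMin (fun y => f y + a * ‖y‖ ^ 2) x) : -(2 * n * a) ≤ lap f x := by
  have key : ∀ i : Fin n, -(2 * a) ≤
      fderiv ℝ (fun y => fderiv ℝ f y (EuclideanSpace.single i 1)) x
        (EuclideanSpace.single i 1) := by
    intro i
    set e : EuclideanSpace ℝ (Fin n) := EuclideanSpace.single i 1 with he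
    have hl : ∀ s : ℝ, HasDerivAt (fun s : ℝ => x + s • e) e s := by
      intro s
      simpa using ((hasDerivAt_id s).smul_const e).const_add x
    have hfd : Differentiable ℝ f := hf.differentiable (by norm_num)
    have hF : ContDiff ℝ 1 (fun y => fderiv ℝ f y e) :=
      (hf.fderiv_right (m := 1) (by norm_num)).clm_apply contDiff_const
    have hFd : Differentiable ℝ (fun y => fderiv ℝ f y e) := hF.differentiable (by norm_num)
    have hnorm : ∀ s : ℝ, ‖x + s • e‖ ^ 2 = ‖x‖ ^ 2 + 2 * s * inner ℝ x e + s ^ 2 := by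
      intro s
      rw [norm_add_sq_real, norm_smul, inner_smul_right]
      have : ‖e‖ = 1 := by simp [he]
      rw [this, mul_one, Real.norm_eq_abs, sq_abs]; ring
    have h1 : ∀ s : ℝ, HasDerivAt (fun s : ℝ => f (x + s • e) + a * ‖x + s • e‖ ^ 2)
        (fderiv ℝ f (x + s • e) e + a * (2 * inner ℝ x e + 2 * s)) s := by
      intro s
      simp_rw [hnorm]
      have hA := (hfd (x + s • e)).hasFDerivAt.comp_hasDerivAt s (hl s)
      have hB : HasDerivAt (fun s : ℝ => ‖x‖ ^ 2 + 2 * s * inner ℝ x e + s ^ 2)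
          (2 * inner ℝ x e + 2 * s) s := by
        have := ((((hasDerivAt_id s).const_mul 2).mul_const (inner ℝ x e)).const_add
          (‖x‖ ^ 2)).add ((hasDerivAt_id s).pow 2)
        refine this.congr_deriv ?_
        simp
      exact hA.add (hB.const_mul a)
    have h2 : HasDerivAt (fun s : ℝ => fderiv ℝ f (x + s • e) e + a * (2 * inner ℝ x e + 2 * s))
        (fderiv ℝ (fun y => fderiv ℝ f y e) x e + a * 2) 0 := by
      have hA := (hFd (x + (0:ℝ) • e)).hasFDerivAt.comp_hasDerivAt 0 (hl 0)
      have hB : HasDerivAt (fun s : ℝ => 2 * inner ℝ x e + 2 * s) 2 0 := by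
        have := ((hasDerivAt_id (0:ℝ)).const_mul 2).const_add (2 * inner ℝ x e)
        simpa using this
      have hz : x + (0:ℝ) • e = x := by simp
      rw [hz] at hA
      exact hA.add (hB.const_mul a)
    have h3 : IsLocalMin (fun s : ℝ => f (x + s • e) + a * ‖x + s • e‖ ^ 2) 0 := by
      have hc : Filter.Tendsto (fun s : ℝ => x + s • e) (nhds 0) (nhds x) := by
        have := (hl 0).continuousAt
        simpa [ContinuousAt] using this
      have := hc.eventually hmin
      filter_upwards [this] with s hs
      simpa using hs
    have := aux_second h1 h2 h3
    linarith
  unfold lap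
  calc -(2 * n * a) = ∑ _i : Fin n, -(2 * a) := by simp; ring
    _ ≤ _ := Finset.sum_le_sum fun i _ => key i

theorem aux_compare {n : ℕ} (hn : 1 ≤ n) {p : ℝ} (hp : 1 ≤ p)
    {u₀ : EuclideanSpace ℝ (Fin n) → ℝ} (hpos : ∀ x, 0 < u₀ x)
    {u : EuclideanSpace ℝ (Fin n) → ℝ → ℝ} (hu : IsSol n p u₀ u)
    {A R τ : ℝ} (hA : 0 < A) (hR : 0 < R) (hτ : 0 < τ)
    (hAR : 2 * n * p * (A ^ p * (R ^ 2) ^ (p - 1)) ≤ 1)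
    (hinit : ∀ x, ‖x‖ ≤ R → A * τ ^ (-(1:ℝ)/p) * (R ^ 2 - ‖x‖ ^ 2) ≤ u₀ x)
    {T : ℝ} (hT : 0 ≤ T) : A * (T + τ) ^ (-(1:ℝ)/p) * R ^ 2 ≤ u 0 T := by
  obtain ⟨hcont, h0, hup, hC2, hpde⟩ := hu
  have hp0 : 0 < p := by linarith
  set b : ℝ → ℝ := fun t => A * (t + τ) ^ (-(1:ℝ)/p) with hb
  have hbpos : ∀ t, 0 ≤ t → 0 < b t := fun t ht =>
    mul_pos hA (Real.rpow_pos_of_pos (by linarith) _)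
  have hbder : ∀ t, 0 ≤ t → HasDerivAt b (-(1/p) * b t / (t + τ)) t := by
    intro t ht
    have hpos' : 0 < t + τ := by linarith
    have := (((hasDerivAt_id t).add_const τ).rpow_const (p := -(1:ℝ)/p)
      (Or.inl (by simpa using hpos'.ne'))).const_mul A
    refine this.congr_deriv ?_
    simp only [hb, id]
    rw [Real.rpow_sub_one hpos'.ne']
    field_simp
  let K : Set (EuclideanSpace ℝ (Fin n) × ℝ) := closedBall 0 R ×ˢ Set.Icc 0 T
  have hK : IsCompact K := (isCompact_closedBall _ _).prod isCompact_Icc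
  have hKne : K.Nonempty := ⟨(0, 0), by simp [K, hR.le, hT]⟩
  let w : EuclideanSpace ℝ (Fin n) × ℝ → ℝ := fun z => u z.1 z.2 - b z.2 * (R ^ 2 - ‖z.1‖ ^ 2)
  have hbc : ContinuousOn b (Set.Ici 0) := fun t ht => (hbder t ht).continuousAt.continuousWithinAt
  have hw : ContinuousOn w K := by
    apply ContinuousOn.sub
    · exact hcont.mono fun z hz => hz.2.1
    · apply ContinuousOn.mul
      · exact hbc.comp continuousOn_snd fun z hz => hz.2.1
      · fun_prop
  obtain ⟨⟨x, t⟩, hxt, hmin⟩ := hK.exists_isMinOn hKne hw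
  have hx : ‖x‖ ≤ R := by simpa using hxt.1
  have ht0 : 0 ≤ t := hxt.2.1
  have htT : t ≤ T := hxt.2.2
  have hminK : ∀ y s, ‖y‖ ≤ R → 0 ≤ s → s ≤ T → w (x, t) ≤ w (y, s) := by
    intro y s hy hs hs'
    exact hmin (show (y, s) ∈ K from ⟨by simpa using hy, hs, hs'⟩)
  suffices hw0 : 0 ≤ w (x, t) by
    have := hminK 0 T (by simpa using hR.le) hT le_rfl
    simp only [w, norm_zero] at this hw0
    simp only [hb] at this
    simp only [hb] at hw0
    have e : R ^ 2 - (0:ℝ) ^ 2 = R ^ 2 := by ring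
    rw [e] at this
    linarith
  by_contra hneg
  push Not at hneg
  have htpos : 0 < t := by
    rcases ht0.lt_or_eq with h | h
    · exact h
    · exfalso
      subst h
      have := hinit x hx
      simp only [w, h0, hb, zero_add] at hneg
      linarith
  have hupos := hup x t htpos
  have hbt := hbpos t ht0
  have hxlt : ‖x‖ < R := by
    rcases hx.lt_or_eq with h | h
    · exact h
    · exfalso
      simp only [w, h] at hneg
      have : b t * (R ^ 2 - R ^ 2) = 0 := by ring
      linarith
  set q : ℝ := R ^ 2 - ‖x‖ ^ 2 with hq
  have hqpos : 0 < q := by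
    have := norm_nonneg x
    nlinarith
  have hqR : q ≤ R ^ 2 := by
    have := sq_nonneg ‖x‖
    linarith
  have huv : u x t < b t * q := by
    simp only [w] at hneg
    linarith
  -- time derivative
  have htime : u x t ^ p * lap (fun y => u y t) x - (-(1/p) * b t / (t + τ)) * q ≤ 0 := by
    refine aux_time htpos ((hpde x t htpos).sub ((hbder t ht0).mul_const q)) ?_
    intro s hs hst
    exact hminK x s hx hs (hst.trans htT)
  have hlap : -(2 * n * b t) ≤ lap (fun y => u y t) x := by
    apply aux_lap (hC2 t htpos)
    have : Metric.ball (0 : EuclideanSpace ℝ (Fin n)) R ∈ nhds x :=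
      Metric.isOpen_ball.mem_nhds (by simpa using hxlt)
    filter_upwards [this] with y hy
    have hy' : ‖y‖ ≤ R := by
      have : ‖y‖ < R := by simpa using hy
      exact this.le
    have := hminK y t hy' ht0 htT
    simp only [w] at this
    nlinarith
  have hn' : (0:ℝ) < n := by exact_mod_cast hn
  have hstrict : u x t ^ p < (b t * q) ^ p := Real.rpow_lt_rpow hupos.le huv hp0
  have hnb : 0 < 2 * n * b t := by positivity
  have h1 : -((b t * q) ^ p * (2 * n * b t)) < u x t ^ p * lap (fun y => u y t) x := by
    have hup0 : 0 < u x t ^ p := Real.rpow_pos_of_pos hupos _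
    nlinarith [mul_le_mul_of_nonneg_left hlap hup0.le, mul_lt_mul_of_pos_right hstrict hnb]
  have h2 : (b t * q) ^ p * (2 * n * b t) ≤ (1/p) * b t / (t + τ) * q := by
    have htτ : 0 < t + τ := by linarith
    have e1 : (b t) ^ p = A ^ p / (t + τ) := by
      simp only [hb]
      rw [Real.mul_rpow hA.le (Real.rpow_nonneg htτ.le _), ← Real.rpow_mul htτ.le]
      have : -(1:ℝ)/p * p = -1 := by field_simp
      rw [this, Real.rpow_neg_one]; rfl
    have e2 : q ^ p = q ^ (p - 1) * q := by
      rw [Real.rpow_sub_one hqpos.ne']; field_simp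
    have e3 : q ^ (p - 1) ≤ (R ^ 2) ^ (p - 1) :=
      Real.rpow_le_rpow hqpos.le hqR (by linarith)
    have hAp : 0 < A ^ p := Real.rpow_pos_of_pos hA _
    rw [Real.mul_rpow hbt.le hqpos.le, e1, e2]
    have h3 : 2 * n * p * (A ^ p * q ^ (p - 1)) ≤ 1 := by
      refine le_trans ?_ hAR
      gcongr
    have h4 : A ^ p / (t + τ) * (q ^ (p - 1) * q) * (2 * n * b t)
        = (2 * n * p * (A ^ p * q ^ (p - 1))) * ((1/p) * b t / (t + τ) * q) := by
      field_simp
    rw [h4]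
    have h5 : 0 ≤ (1/p) * b t / (t + τ) * q := by positivity
    nlinarith
  have h6 : (-(1/p) * b t / (t + τ)) * q = -((1/p) * b t / (t + τ) * q) := by ring
  rw [h6] at htime
  linarith

theorem aux_sup {n : ℕ} {f : EuclideanSpace ℝ (Fin n) → ℝ} (hf : Continuous f)
    (x : EuclideanSpace ℝ (Fin n)) : ENNReal.ofReal (f x) ≤ eLpNorm f ⊤ volume := by
  rw [eLpNorm_exponent_top]
  refine le_trans (Real.ofReal_le_enorm (f x)) ?_
  by_contra hlt
  push Not at hlt
  have hopen : IsOpen {y | eLpNormEssSup f volume < ‖f y‖ₑ} :=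
    isOpen_lt continuous_const hf.enorm
  have hz : volume {y | eLpNormEssSup f volume < ‖f y‖ₑ} = 0 := meas_eLpNormEssSup_lt
  rw [hopen.measure_eq_zero_iff volume] at hz
  have : x ∈ ({y | eLpNormEssSup f volume < ‖f y‖ₑ} : Set _) := hlt
  rw [hz] at this
  exact this

/-- Theorem 1.6 of Fila–Winkler, lower bound.
Let `p ≥ 1` and let `Λ ∈ C⁰([0,∞))` be strictly increasing with `Λ(s)/ln s → ∞` as
`s → ∞`.  If `u` is a positive classical solution of the Cauchy problem with
`u₀(x) ≥ e^{-Λ(|x|)}`, then there are `t₀ > 0` and `C > 0` such that for each `t ≥ t₀`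
the value `C ln t` is attained by `Λ` at some (unique) `s ≥ 0`, and
`‖u(·,t)‖_{L^∞(ℝⁿ)} ≥ C t^{-1/p} s^{2/p}`, the `L^∞` norm being the essential
supremum `eLpNorm · ∞`. -/
theorem stmt_12 (n : ℕ) (hn : 1 ≤ n)
    (p : ℝ) (hp : 1 ≤ p)
    (Λ : ℝ → ℝ)
    (hΛcont : ContinuousOn Λ (Set.Ici 0))
    (hΛmono : StrictMonoOn Λ (Set.Ici 0))
    (hΛgrow : Filter.Tendsto (fun s => Λ s / Real.log s) Filter.atTop Filter.atTop)
    (u₀ : EuclideanSpace ℝ (Fin n) → ℝ)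
    (hu₀cont : Continuous u₀)
    (hu₀dec : ∀ x, Real.exp (-Λ ‖x‖) ≤ u₀ x)
    (u : EuclideanSpace ℝ (Fin n) → ℝ → ℝ)
    (hu : IsSol n p u₀ u) :
    ∃ t₀ > (0:ℝ), ∃ C > (0:ℝ), ∀ t ≥ t₀, ∃ s ∈ Set.Ici (0:ℝ),
      Λ s = C * Real.log t ∧
      ENNReal.ofReal (C * t ^ (-(1:ℝ)/p) * s ^ ((2:ℝ)/p)) ≤
        eLpNorm (fun x => u x t) ⊤ volume := by
  have hp0 : 0 < p := by linarith
  have hn' : (1:ℝ) ≤ n := by exact_mod_cast hn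
  have hN : 1 ≤ 2 * n * p := by nlinarith
  have hN0 : 0 < 2 * n * p := by linarith
  set c : ℝ := (2 * n * p) ^ (-(1:ℝ)/p) with hc
  have hcpos : 0 < c := Real.rpow_pos_of_pos hN0 _
  have hcp : c ^ p = (2 * n * p)⁻¹ := by
    rw [hc, ← Real.rpow_mul hN0.le]
    have : -(1:ℝ)/p * p = -1 := by field_simp
    rw [this, Real.rpow_neg_one]
  have hcp1 : c ^ p ≤ 1 := by rw [hcp]; exact inv_le_one_of_one_le₀ hN
  set C : ℝ := min (1/(p+2)) (c * 2 ^ (-(1:ℝ)/p)) with hC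
  have hCpos : 0 < C := lt_min (by positivity) (by positivity)
  have hC1 : C * (p + 2) ≤ 1 := by
    have : C ≤ 1/(p+2) := min_le_left _ _
    rwa [le_div_iff₀ (by positivity)] at this
  have hC2 : C ≤ c * 2 ^ (-(1:ℝ)/p) := min_le_right _ _
  obtain ⟨S, hS⟩ : ∃ S, ∀ s ≥ S, 1 ≤ Λ s / Real.log s :=
    Filter.eventually_atTop.1 (hΛgrow.eventually_ge_atTop 1)
  set S' : ℝ := max S 2 with hS'
  have hS'2 : 2 ≤ S' := le_max_right _ _
  have hlogle : ∀ s ≥ S', Real.log s ≤ Λ s := by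
    intro s hs
    have h1 := hS s ((le_max_left _ _).trans hs)
    have : 0 < Real.log s := Real.log_pos (by linarith)
    rwa [le_div_iff₀ this, one_mul] at h1
  obtain ⟨t₁, ht₁⟩ : ∃ t₁, ∀ t ≥ t₁, Λ S' ≤ C * Real.log t :=
    Filter.eventually_atTop.1
      ((Real.tendsto_log_atTop.const_mul_atTop hCpos).eventually_ge_atTop _)
  refine ⟨max t₁ 1, by positivity, C, hCpos, ?_⟩
  intro t ht
  have ht1 : 1 ≤ t := (le_max_right _ _).trans ht
  have htpos : 0 < t := by linarith
  have hlow := ht₁ t ((le_max_left _ _).trans ht)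
  set L : ℝ := C * Real.log t with hL
  set B : ℝ := max S' (Real.exp L) with hB
  have hBS : S' ≤ B := le_max_left _ _
  have hhigh : L ≤ Λ B := by
    refine le_trans ?_ (hlogle B hBS)
    rw [Real.le_log_iff_exp_le (by linarith)]
    exact le_max_right _ _
  obtain ⟨R, hRmem, hRL⟩ : L ∈ Λ '' Set.Icc S' B :=
    intermediate_value_Icc hBS (hΛcont.mono fun z hz => by
      have := hz.1
      simp only [Set.mem_Ici]; linarith) ⟨hlow, hhigh⟩
  have hRS : S' ≤ R := hRmem.1
  have hRpos : 0 < R := by linarith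
  refine ⟨R, hRpos.le, hRL, ?_⟩
  have hexpL : Real.exp L = t ^ C := by
    rw [Real.rpow_def_of_pos htpos, hL, mul_comm]
  have hRexp : R ≤ Real.exp L := by
    rw [← Real.log_le_iff_le_exp hRpos, ← hRL]
    exact hlogle R hRS
  have hR2 : 0 < R ^ 2 := by positivity
  set A : ℝ := c * (R ^ 2) ^ (1/p - 1) with hA
  have hApos : 0 < A := mul_pos hcpos (Real.rpow_pos_of_pos hR2 _)
  have hAp : A ^ p * (R ^ 2) ^ (p - 1) = (2 * n * p)⁻¹ := by
    rw [hA, Real.mul_rpow hcpos.le (Real.rpow_nonneg hR2.le _), ← Real.rpow_mul hR2.le,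
      mul_assoc, ← Real.rpow_add hR2, hcp]
    have : (1/p - 1) * p + (p - 1) = 0 := by field_simp; ring
    rw [this, Real.rpow_zero, mul_one]
  have hAR2 : A * R ^ 2 = c * (R ^ 2) ^ (1/p) := by
    rw [hA, Real.rpow_sub_one hR2.ne']; field_simp
  have hupos : ∀ x, 0 < u₀ x := fun x => (Real.exp_pos _).trans_le (hu₀dec x)
  have htinit : t ^ (-(1:ℝ)/p) * (A * R ^ 2) ≤ Real.exp (-L) := by
    -- `R ^ 2 ≤ t ^ (2 C)` and `C (p + 2) ≤ 1`
    have hc1 : c ≤ 1 := by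
      by_contra h
      push Not at h
      have := Real.one_lt_rpow h hp0
      linarith
    have h1 : (R ^ 2) ^ (1/p) ≤ Real.exp (L * (2/p)) := by
      have : (R ^ 2) ≤ Real.exp (2 * L) := by
        have h := pow_le_pow_left₀ hRpos.le hRexp 2
        rwa [← Real.exp_nat_mul, Nat.cast_ofNat] at h
      calc (R ^ 2) ^ (1/p) ≤ (Real.exp (2 * L)) ^ (1/p) :=
            Real.rpow_le_rpow hR2.le this (by positivity)
        _ = _ := by rw [← Real.exp_mul]; congr 1; ring
    have h2 : A * R ^ 2 ≤ Real.exp (L * (2/p)) := by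
      rw [hAR2]
      have : 0 ≤ (R ^ 2) ^ (1/p) := Real.rpow_nonneg hR2.le _
      nlinarith
    calc t ^ (-(1:ℝ)/p) * (A * R ^ 2) ≤ t ^ (-(1:ℝ)/p) * Real.exp (L * (2/p)) := by gcongr
      _ = Real.exp (Real.log t * (-1/p) + L * (2/p)) := by
        rw [Real.rpow_def_of_pos htpos, ← Real.exp_add]
      _ ≤ Real.exp (-L) := by
        apply Real.exp_le_exp.2
        have hl : 0 ≤ Real.log t := Real.log_nonneg ht1
        have : Real.log t * (-1/p) + L * (2/p) + L = Real.log t * (C * (p + 2) - 1) / p := by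
          rw [hL]; field_simp; ring
        have h3 : Real.log t * (C * (p + 2) - 1) / p ≤ 0 :=
          div_nonpos_of_nonpos_of_nonneg (mul_nonpos_of_nonneg_of_nonpos hl (by linarith)) hp0.le
        linarith
  have hcmp := aux_compare hn hp hupos hu hApos hRpos htpos
    (by rw [hAp, mul_inv_cancel₀ hN0.ne']) (by
      intro x hx
      refine le_trans ?_ (hu₀dec x)
      have h1 : Real.exp (-L) ≤ Real.exp (-Λ ‖x‖) := by
        apply Real.exp_le_exp.2
        rw [← hRL]
        exact neg_le_neg (hΛmono.monotoneOn (norm_nonneg x) hRpos.le hx)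
      refine le_trans (le_trans ?_ htinit) h1
      have h2 : 0 < A * t ^ (-(1:ℝ)/p) := mul_pos hApos (Real.rpow_pos_of_pos htpos _)
      nlinarith [mul_nonneg h2.le (sq_nonneg ‖x‖)]) htpos.le
  refine le_trans (ENNReal.ofReal_le_ofReal ?_) (aux_sup (hu.2.2.2.1 t htpos).continuous 0)
  refine le_trans ?_ hcmp
  have e1 : (t + t) ^ (-(1:ℝ)/p) = 2 ^ (-(1:ℝ)/p) * t ^ (-(1:ℝ)/p) := by
    rw [← two_mul, Real.mul_rpow (by norm_num) htpos.le]
  have e2 : R ^ ((2:ℝ)/p) = (R ^ 2) ^ (1/p) := by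
    rw [← Real.rpow_natCast R 2, ← Real.rpow_mul hRpos.le]
    congr 1
    push_cast
    ring
  have e3 : A * (t + t) ^ (-(1:ℝ)/p) * R ^ 2
      = (c * 2 ^ (-(1:ℝ)/p)) * t ^ (-(1:ℝ)/p) * R ^ ((2:ℝ)/p) := by
    rw [e1, e2]
    linear_combination (2 ^ (-(1:ℝ)/p) * t ^ (-(1:ℝ)/p)) * hAR2
  rw [e3]
  gcongr
end
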